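/- (Theorem 3.1, asymptotic stability) Under the standing hypotheses, if either C'(t) ≤ 0 for all t ≥ 0 or C'(t) → 0 as t → ∞, and if moreover ∫₀^∞ dt/g(t) = ∞, then the null solution is asymptotically stable: it is stable, and there exists κ ≥ 0 such that for every t₀ ≥ κ there is δ(t₀) > 0 such that every classical solution u on [t₀,∞) with d(t₀) < δ(t₀) satisfies d(t) → 0 as t → ∞. -/

import Mathlib

open Real Set MeasureTheory Filter

/-- A classical solution on `[t₀, ∞)` of the initial-boundary-value problem
`-ε(t) u_xxt + u_tt - C(t) u_xx + a' u_t = F(u) - a u_t` on `(0,π) × (t₀,∞)`,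
with Dirichlet boundary conditions `u(0,t) = u(π,t) = 0`.  The partial
derivatives are recorded as data, together with the hypotheses that they really
are the derivatives and that all of them are continuous on the closed
space-time domain. -/
structure ClassicalSolution (ε C F : ℝ → ℝ) (a' t₀ : ℝ) where
  u : ℝ → ℝ → ℝ
  ux : ℝ → ℝ → ℝ
  uxx : ℝ → ℝ → ℝ
  ut : ℝ → ℝ → ℝ
  utt : ℝ → ℝ → ℝ
  uxxt : ℝ → ℝ → ℝ
  aa : ℝ → ℝ → ℝ
  hux : ∀ t ∈ Ici t₀, ∀ x ∈ Icc (0:ℝ) π,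
    HasDerivWithinAt (fun y => u y t) (ux x t) (Icc 0 π) x
  huxx : ∀ t ∈ Ici t₀, ∀ x ∈ Icc (0:ℝ) π,
    HasDerivWithinAt (fun y => ux y t) (uxx x t) (Icc 0 π) x
  hut : ∀ x ∈ Icc (0:ℝ) π, ∀ t ∈ Ici t₀,
    HasDerivWithinAt (fun s => u x s) (ut x t) (Ici t₀) t
  hutt : ∀ x ∈ Icc (0:ℝ) π, ∀ t ∈ Ici t₀,
    HasDerivWithinAt (fun s => ut x s) (utt x t) (Ici t₀) t
  huxxt : ∀ x ∈ Icc (0:ℝ) π, ∀ t ∈ Ici t₀,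
    HasDerivWithinAt (fun s => uxx x s) (uxxt x t) (Ici t₀) t
  cont_u : ContinuousOn (Function.uncurry u) (Icc 0 π ×ˢ Ici t₀)
  cont_ux : ContinuousOn (Function.uncurry ux) (Icc 0 π ×ˢ Ici t₀)
  cont_uxx : ContinuousOn (Function.uncurry uxx) (Icc 0 π ×ˢ Ici t₀)
  cont_ut : ContinuousOn (Function.uncurry ut) (Icc 0 π ×ˢ Ici t₀)
  cont_utt : ContinuousOn (Function.uncurry utt) (Icc 0 π ×ˢ Ici t₀)
  cont_uxxt : ContinuousOn (Function.uncurry uxxt) (Icc 0 π ×ˢ Ici t₀)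
  cont_aa : ContinuousOn (Function.uncurry aa) (Icc 0 π ×ˢ Ici t₀)
  aa_nonneg : ∀ x ∈ Icc (0:ℝ) π, ∀ t ∈ Ici t₀, 0 ≤ aa x t
  pde : ∀ x ∈ Ioo (0:ℝ) π, ∀ t ∈ Ioi t₀,
    -(ε t) * uxxt x t + utt x t - C t * uxx x t + a' * ut x t
      = F (u x t) - aa x t * ut x t
  bc0 : ∀ t ∈ Ici t₀, u 0 t = 0
  bcπ : ∀ t ∈ Ici t₀, u π t = 0

/-- The time-dependent norm `d(t)` of a solution:
`d(t)² = ∫₀^π [ε(t)² u_xx² + u_x² + u² + u_t²] dx`. -/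
noncomputable def ClassicalSolution.d {ε C F : ℝ → ℝ} {a' t₀ : ℝ}
    (S : ClassicalSolution ε C F a' t₀) (t : ℝ) : ℝ :=
  Real.sqrt (∫ x in (0:ℝ)..π,
    ((ε t)^2 * (S.uxx x t)^2 + (S.ux x t)^2 + (S.u x t)^2 + (S.ut x t)^2))


/-! ### Calculus on `[0, π]` -/

lemma aux_icc_deriv_at {f f' : ℝ → ℝ}
    (h : ∀ x ∈ Icc (0:ℝ) π, HasDerivWithinAt f (f' x) (Icc 0 π) x) :
    ∀ x ∈ Ioo (0:ℝ) π, HasDerivAt f (f' x) x :=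
  fun x hx => (h x ⟨hx.1.le, hx.2.le⟩).hasDerivAt (Icc_mem_nhds hx.1 hx.2)

lemma aux_icc_cont {f f' : ℝ → ℝ}
    (h : ∀ x ∈ Icc (0:ℝ) π, HasDerivWithinAt f (f' x) (Icc 0 π) x) :
    ContinuousOn f (Icc 0 π) := fun x hx => (h x hx).continuousWithinAt

lemma aux_ii {f : ℝ → ℝ} (h : ContinuousOn f (Icc 0 π)) :
    IntervalIntegrable f volume 0 π :=
  h.intervalIntegrable_of_Icc pi_pos.le

lemma aux_ibp {f f' g g' : ℝ → ℝ}
    (hf : ∀ x ∈ Icc (0:ℝ) π, HasDerivWithinAt f (f' x) (Icc 0 π) x)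
    (hg : ∀ x ∈ Icc (0:ℝ) π, HasDerivWithinAt g (g' x) (Icc 0 π) x)
    (hf' : ContinuousOn f' (Icc 0 π)) (hg' : ContinuousOn g' (Icc 0 π))
    (h0 : f 0 = 0) (hπ : f π = 0) :
    ∫ x in (0:ℝ)..π, f x * g' x = - ∫ x in (0:ℝ)..π, f' x * g x := by
  have e : uIcc (0:ℝ) π = Icc 0 π := uIcc_of_le pi_pos.le
  have := intervalIntegral.integral_mul_deriv_eq_deriv_mul_of_hasDerivWithinAt
    (a := 0) (b := π) (u := f) (v := g) (u' := f') (v' := g')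
    (by rw [e]; exact hf) (by rw [e]; exact hg) (aux_ii hf') (aux_ii hg')
  rw [this, h0, hπ]; ring

lemma aux_poincare_lt {f f' : ℝ → ℝ} {l : ℝ} (hl0 : 0 < l) (hl : l < 1)
    (hf : ∀ x ∈ Icc (0:ℝ) π, HasDerivWithinAt f (f' x) (Icc 0 π) x)
    (hf' : ContinuousOn f' (Icc 0 π)) (h0 : f 0 = 0) (hπ : f π = 0) :
    l ^ 2 * ∫ x in (0:ℝ)..π, f x ^ 2 ≤ ∫ x in (0:ℝ)..π, f' x ^ 2 := by
  have hfc := aux_icc_cont hf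
  have hcos : ∀ x ∈ Icc (0:ℝ) π, cos (l * (x - π / 2)) ≠ 0 := by
    intro x hx
    apply ne_of_gt
    apply cos_pos_of_mem_Ioo
    have := pi_pos
    constructor <;> nlinarith [hx.1, hx.2]
  set c : ℝ → ℝ := fun x => - l * tan (l * (x - π / 2)) with hc
  have hcd : ∀ x ∈ Icc (0:ℝ) π, HasDerivAt c (- l ^ 2 - c x ^ 2) x := by
    intro x hx
    have h1 : HasDerivAt (fun x : ℝ => l * (x - π / 2)) l x := by
      simpa using ((hasDerivAt_id x).sub_const (π / 2)).const_mul l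
    have h2 := ((Real.hasDerivAt_tan (hcos x hx)).comp x h1).const_mul (- l)
    refine h2.congr_deriv ?_
    have h3 := hcos x hx
    have h4 := sin_sq_add_cos_sq (l * (x - π / 2))
    simp only [hc, tan_eq_sin_div_cos]
    generalize cos (l * (x - π / 2)) = p at *
    generalize sin (l * (x - π / 2)) = q at *
    have h5 : q ^ 2 = 1 - p ^ 2 := by linarith
    rw [mul_pow, div_pow, h5]
    field_simp
    ring
  have hcc : ContinuousOn c (Icc 0 π) := fun x hx => (hcd x hx).continuousAt.continuousWithinAt
  have key := intervalIntegral.sub_le_integral_of_hasDeriv_right_of_le (a := 0) (b := π)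
    (g := fun x => f x ^ 2 * c x)
    (g' := fun x => 2 * f x * f' x * c x + f x ^ 2 * (- l ^ 2 - c x ^ 2))
    (φ := fun x => f' x ^ 2 - l ^ 2 * f x ^ 2) pi_pos.le (by fun_prop)
    (by
      intro x hx
      have h1 := (aux_icc_deriv_at hf x hx).fun_pow 2
      have h2 := (h1.fun_mul (hcd x ⟨hx.1.le, hx.2.le⟩)).hasDerivWithinAt (s := Ioi x)
      refine h2.congr_deriv ?_
      push_cast; ring)
    (ContinuousOn.integrableOn_Icc (by fun_prop))
    (by
      intro x hx
      nlinarith [sq_nonneg (f' x - f x * c x)])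
  rw [intervalIntegral.integral_sub (aux_ii (by fun_prop)) (aux_ii (by fun_prop)),
    intervalIntegral.integral_const_mul] at key
  simp only [h0, hπ] at key
  linarith

lemma aux_poincare {f f' : ℝ → ℝ}
    (hf : ∀ x ∈ Icc (0:ℝ) π, HasDerivWithinAt f (f' x) (Icc 0 π) x)
    (hf' : ContinuousOn f' (Icc 0 π)) (h0 : f 0 = 0) (hπ : f π = 0) :
    ∫ x in (0:ℝ)..π, f x ^ 2 ≤ ∫ x in (0:ℝ)..π, f' x ^ 2 := by
  have h1 : Tendsto (fun l : ℝ => l ^ 2 * ∫ x in (0:ℝ)..π, f x ^ 2) (nhdsWithin 1 (Iio 1))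
      (nhds ((1:ℝ) ^ 2 * ∫ x in (0:ℝ)..π, f x ^ 2)) := by
    apply Tendsto.mono_left _ nhdsWithin_le_nhds
    apply Continuous.tendsto
    fun_prop
  rw [one_pow, one_mul] at h1
  refine le_of_tendsto h1 ?_
  have : Ioo (0:ℝ) 1 ∈ nhdsWithin (1:ℝ) (Iio 1) := Ioo_mem_nhdsLT (by norm_num)
  filter_upwards [this] with l hl
  exact aux_poincare_lt hl.1 hl.2 hf hf' h0 hπ

lemma aux_sup {f f' : ℝ → ℝ}
    (hf : ∀ x ∈ Icc (0:ℝ) π, HasDerivWithinAt f (f' x) (Icc 0 π) x)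
    (hf' : ContinuousOn f' (Icc 0 π)) (h0 : f 0 = 0) :
    ∀ x ∈ Icc (0:ℝ) π, f x ^ 2 ≤ π * ∫ y in (0:ℝ)..π, f' y ^ 2 := by
  intro x hx
  have hfc := aux_icc_cont hf
  have hpi := pi_pos
  have hsub : Icc 0 x ⊆ Icc (0:ℝ) π := Icc_subset_Icc_right hx.2
  set s := f x / π with hs
  have key := intervalIntegral.sub_le_integral_of_hasDeriv_right_of_le (a := 0) (b := x)
    (g := fun y => 2 * s * f y) (g' := fun y => 2 * s * f' y)
    (φ := fun y => s ^ 2 + f' y ^ 2) hx.1 ((hfc.mono hsub).const_mul _)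
    (by
      intro y hy
      exact ((aux_icc_deriv_at hf y ⟨hy.1, hy.2.trans_le hx.2⟩).const_mul (2 * s)).hasDerivWithinAt)
    (ContinuousOn.integrableOn_Icc (by have := hf'.mono hsub; fun_prop))
    (by intro y hy; nlinarith [sq_nonneg (s - f' y)])
  have hi : IntervalIntegrable (fun y => f' y ^ 2) volume 0 π := aux_ii (by fun_prop)
  have hi1 : IntervalIntegrable (fun y => f' y ^ 2) volume 0 x :=
    hi.mono_set (by rw [uIcc_of_le hx.1, uIcc_of_le hpi.le]; exact hsub)
  rw [intervalIntegral.integral_add (by simp) hi1] at key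
  have h2 : ∫ y in (0:ℝ)..x, f' y ^ 2 ≤ ∫ y in (0:ℝ)..π, f' y ^ 2 :=
    intervalIntegral.integral_mono_interval le_rfl hx.1 hx.2
      (Eventually.of_forall fun y => sq_nonneg _) hi
  simp only [h0, intervalIntegral.integral_const, smul_eq_mul] at key
  have hfs : f x = s * π := by rw [hs]; field_simp
  have h3 : x * s ^ 2 ≤ π * s ^ 2 := mul_le_mul_of_nonneg_right hx.2 (sq_nonneg _)
  have h4 : π * s ^ 2 ≤ ∫ y in (0:ℝ)..π, f' y ^ 2 := by
    rw [hfs] at key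
    nlinarith
  rw [hfs]
  nlinarith [mul_le_mul_of_nonneg_left h4 hpi.le]

/-! ### The nonlinearity -/

lemma aux_F {G G' Ψ : ℝ → ℝ} {k ρ : ℝ} (hG : ∀ z, HasDerivAt G (G' z) z) (hG0 : G 0 = 0)
    (hk : ∀ z, |z| < ρ → G' z ≤ k) (hΨ : ∀ z, HasDerivAt Ψ (G z) z) (hΨ0 : Ψ 0 = 0) :
    ∀ z, |z| < ρ → z * G z ≤ k * z ^ 2 ∧ Ψ z ≤ k * z ^ 2 / 2 := by
  have hmono : AntitoneOn (fun z => G z - k * z) (Ioo (-ρ) ρ) := by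
    apply antitoneOn_of_hasDerivWithinAt_nonpos (f' := fun z => G' z - k) (convex_Ioo _ _)
    · intro z _
      exact (((hG z).continuousAt).sub (by fun_prop)).continuousWithinAt
    · intro z _
      simpa using ((hG z).fun_sub ((hasDerivAt_id z).const_mul k)).hasDerivWithinAt
    · intro z hz
      rw [interior_Ioo] at hz
      have := hk z (abs_lt.2 hz)
      simpa using this
  have h1 : ∀ z, |z| < ρ → z * G z ≤ k * z ^ 2 := by
    intro z hz
    have hz' := abs_lt.1 hz
    have hρ : 0 < ρ := (abs_nonneg z).trans_lt hz
    rcases le_total 0 z with h | h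
    · have := hmono ⟨by linarith, hρ⟩ hz' h
      simp only [hG0] at this
      nlinarith
    · have := hmono hz' ⟨by linarith, hρ⟩ h
      simp only [hG0] at this
      nlinarith
  intro z hz
  refine ⟨h1 z hz, ?_⟩
  have hd : ∀ y, HasDerivAt (fun s => Ψ (s * z) - k * (s * z) ^ 2 / 2)
      (z * G (y * z) - k * (y * z ^ 2)) y := by
    intro y
    have e : HasDerivAt (fun s : ℝ => s * z) z y := by simpa using (hasDerivAt_id y).mul_const z
    have e1 := (hΨ (y * z)).comp y e
    have e2 := ((e.fun_pow 2).const_mul k).div_const 2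
    refine (e1.sub e2).congr_deriv ?_
    push_cast; ring
  have hanti : AntitoneOn (fun s => Ψ (s * z) - k * (s * z) ^ 2 / 2) (Icc 0 1) := by
    apply antitoneOn_of_hasDerivWithinAt_nonpos (convex_Icc _ _)
      (fun y _ => (hd y).continuousAt.continuousWithinAt) (fun y _ => (hd y).hasDerivWithinAt)
    intro y hy
    rw [interior_Icc] at hy
    have hyz : |y * z| < ρ := by
      rw [abs_mul, abs_of_pos hy.1]
      nlinarith [abs_nonneg z, hy.1, hy.2]
    have := h1 _ hyz
    have h3 : y * (z * G (y * z) - k * (y * z ^ 2)) ≤ 0 := by nlinarith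
    by_contra hcon
    push Not at hcon
    nlinarith [mul_pos hy.1 hcon]
  have := hanti (left_mem_Icc.2 zero_le_one) (right_mem_Icc.2 zero_le_one) zero_le_one
  simp only [one_mul, zero_mul, hΨ0] at this
  linarith

/-! ### Integrals depending on a parameter -/

lemma aux_slice {f : ℝ → ℝ → ℝ} {t₀ t : ℝ}
    (hc : ContinuousOn (Function.uncurry f) (Icc 0 π ×ˢ Ici t₀)) (ht : t₀ ≤ t) :
    ContinuousOn (fun x => f x t) (Icc 0 π) :=
  hc.comp (f := fun x : ℝ => (x, t)) (by fun_prop) (fun x hx => ⟨hx, ht⟩)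

lemma aux_param_cont {f : ℝ → ℝ → ℝ} {t₀ : ℝ}
    (hc : ContinuousOn (Function.uncurry f) (Icc 0 π ×ˢ Ici t₀)) :
    ContinuousOn (fun t => ∫ x in (0:ℝ)..π, f x t) (Ici t₀) := by
  have hg : Continuous (Function.uncurry
      (fun t x : ℝ => f (max 0 (min π x)) (max t₀ t))) := by
    have := hc.comp_continuous (f := fun p : ℝ × ℝ => (max 0 (min π p.2), max t₀ p.1))
      (by fun_prop) (fun p => ⟨⟨le_max_left _ _, max_le pi_pos.le (min_le_left _ _)⟩,
        mem_Ici.2 (le_max_left _ _)⟩)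
    exact this
  have h2 : Continuous (fun t => ∫ x in (0:ℝ)..π, f (max 0 (min π x)) (max t₀ t)) :=
    intervalIntegral.continuous_parametric_intervalIntegral_of_continuous' hg 0 π
  refine h2.continuousOn.congr ?_
  intro t ht
  apply intervalIntegral.integral_congr
  intro x hx
  rw [uIcc_of_le pi_pos.le] at hx
  simp only [min_eq_right hx.2, max_eq_right hx.1, max_eq_right (mem_Ici.1 ht)]

lemma aux_param_deriv {f f' : ℝ → ℝ → ℝ} {t₀ t b : ℝ}
    (hc : ContinuousOn (Function.uncurry f) (Icc 0 π ×ˢ Ici t₀))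
    (hc' : ContinuousOn (Function.uncurry f') (Icc 0 π ×ˢ Ici t₀))
    (hd : ∀ x ∈ Icc (0:ℝ) π, ∀ s, t₀ < s → HasDerivAt (f x) (f' x s) s)
    (ht : t₀ < t) (hb : b ∈ Icc 0 π) :
    HasDerivAt (fun s => ∫ x in (0:ℝ)..b, f x s) (∫ x in (0:ℝ)..b, f' x t) t := by
  have hcomp : IsCompact (Icc (0:ℝ) π ×ˢ Icc t₀ (t + 1)) := isCompact_Icc.prod isCompact_Icc
  obtain ⟨M, hM⟩ := hcomp.exists_bound_of_continuousOn
    (hc'.mono (prod_mono_right Icc_subset_Ici_self))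
  have hsub : Icc 0 b ⊆ Icc (0:ℝ) π := Icc_subset_Icc_right hb.2
  have hI : uIoc 0 b ⊆ Icc (0:ℝ) π := by
    rw [uIoc_of_le hb.1]; exact Ioc_subset_Icc_self.trans hsub
  have hint : ∀ g : ℝ → ℝ, ContinuousOn g (Icc 0 π) → IntervalIntegrable g volume 0 b :=
    fun g hg => (hg.mono hsub).intervalIntegrable_of_Icc hb.1
  refine (intervalIntegral.hasDerivAt_integral_of_dominated_loc_of_deriv_le
    (F := fun s x => f x s) (F' := fun s x => f' x s) (bound := fun _ => M)
    (s := Ioo t₀ (t + 1)) (Ioo_mem_nhds ht (by linarith)) ?_ ?_ ?_ ?_ ?_ ?_).2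
  · filter_upwards [lt_mem_nhds ht] with s hs
    exact (intervalIntegrable_iff.1 (hint _ (aux_slice hc hs.le))).aestronglyMeasurable
  · exact hint _ (aux_slice hc ht.le)
  · exact (intervalIntegrable_iff.1 (hint _ (aux_slice hc' ht.le))).aestronglyMeasurable
  · refine Eventually.of_forall fun x hx s hs => ?_
    exact hM (x, s) ⟨hI hx, hs.1.le, hs.2.le⟩
  · simp
  · exact Eventually.of_forall fun x hx s hs => hd x (hI hx) s hs.1

/-! ### Regularity of `u_t` in space -/

lemma aux_ftc {h : ℝ → ℝ} (hh : ContinuousOn h (Icc 0 π)) :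
    ∀ x ∈ Icc (0:ℝ) π, HasDerivWithinAt (fun x => ∫ y in (0:ℝ)..x, h y) (h x) (Icc 0 π) x := by
  intro x hx
  have hg : Continuous (fun x : ℝ => h (max 0 (min π x))) :=
    hh.comp_continuous (f := fun x : ℝ => max 0 (min π x)) (by fun_prop)
      (fun p => ⟨le_max_left _ _, max_le pi_pos.le (min_le_left _ _)⟩)
  have h1 := (hg.integral_hasStrictDerivAt 0 x).hasDerivAt.hasDerivWithinAt (s := Icc 0 π)
  rw [min_eq_right hx.2, max_eq_right hx.1] at h1
  have e : ∀ z ∈ Icc (0:ℝ) π,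
      (∫ y in (0:ℝ)..z, h y) = ∫ y in (0:ℝ)..z, h (max 0 (min π y)) := by
    intro z hz
    apply intervalIntegral.integral_congr
    intro y hy
    rw [uIcc_of_le hz.1] at hy
    simp only [min_eq_right (hy.2.trans hz.2), max_eq_right hy.1]
  exact h1.congr e (e x hx)

lemma aux_rep {f f' h : ℝ → ℝ}
    (hf : ∀ x ∈ Icc (0:ℝ) π, HasDerivWithinAt f (f' x) (Icc 0 π) x)
    (hf' : ∀ x ∈ Icc (0:ℝ) π, HasDerivWithinAt f' (h x) (Icc 0 π) x)
    (hh : ContinuousOn h (Icc 0 π)) (h0 : f 0 = 0) :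
    ∀ x ∈ Icc (0:ℝ) π, f x = x * f' 0 + ∫ y in (0:ℝ)..x, (x - y) * h y := by
  intro x hx
  have hsub : Icc 0 x ⊆ Icc (0:ℝ) π := Icc_subset_Icc_right hx.2
  have hfc := (aux_icc_cont hf).mono hsub
  have hfc' := (aux_icc_cont hf').mono hsub
  have hhc := hh.mono hsub
  have := intervalIntegral.integral_eq_sub_of_hasDerivAt_of_le (a := 0) (b := x)
    (f := fun y => (x - y) * f' y + f y) (f' := fun y => (x - y) * h y) hx.1
    (by fun_prop)
    (by
      intro y hy
      have hy' : y ∈ Ioo 0 π := ⟨hy.1, hy.2.trans_le hx.2⟩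
      have e1 := aux_icc_deriv_at hf y hy'
      have e2 := aux_icc_deriv_at hf' y hy'
      have e3 : HasDerivAt (fun y : ℝ => x - y) (-1) y := by
        simpa using (hasDerivAt_id y).const_sub x
      refine ((e3.fun_mul e2).fun_add e1).congr_deriv ?_
      ring)
    (ContinuousOn.intervalIntegrable_of_Icc hx.1 (by fun_prop))
  rw [this, h0]
  ring

section sol
variable {ε C F : ℝ → ℝ} {a' t₀ : ℝ}

lemma ClassicalSolution.hut' (S : ClassicalSolution ε C F a' t₀) :
    ∀ x ∈ Icc (0:ℝ) π, ∀ s, t₀ < s → HasDerivAt (S.u x) (S.ut x s) s :=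
  fun x hx s hs => (S.hut x hx s (mem_Ici.2 hs.le)).hasDerivAt (Ici_mem_nhds hs)

lemma ClassicalSolution.hutt' (S : ClassicalSolution ε C F a' t₀) :
    ∀ x ∈ Icc (0:ℝ) π, ∀ s, t₀ < s → HasDerivAt (S.ut x) (S.utt x s) s :=
  fun x hx s hs => (S.hutt x hx s (mem_Ici.2 hs.le)).hasDerivAt (Ici_mem_nhds hs)

lemma ClassicalSolution.huxxt' (S : ClassicalSolution ε C F a' t₀) :
    ∀ x ∈ Icc (0:ℝ) π, ∀ s, t₀ < s → HasDerivAt (S.uxx x) (S.uxxt x s) s :=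
  fun x hx s hs => (S.huxxt x hx s (mem_Ici.2 hs.le)).hasDerivAt (Ici_mem_nhds hs)

lemma ClassicalSolution.ut_boundary (S : ClassicalSolution ε C F a' t₀) {t : ℝ} (ht : t₀ < t) :
    S.ut 0 t = 0 ∧ S.ut π t = 0 := by
  have key : ∀ x ∈ Icc (0:ℝ) π, (∀ s ∈ Ici t₀, S.u x s = 0) → S.ut x t = 0 := by
    intro x hx h
    have h1 := S.hut' x hx t ht
    have h2 : HasDerivAt (S.u x) 0 t := by
      refine (hasDerivAt_const t (0:ℝ)).congr_of_eventuallyEq ?_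
      filter_upwards [lt_mem_nhds ht] with s hs
      exact h s hs.le
    exact h1.unique h2
  exact ⟨key 0 ⟨le_rfl, pi_pos.le⟩ S.bc0, key π ⟨pi_pos.le, le_rfl⟩ S.bcπ⟩

lemma ClassicalSolution.exists_uxt (S : ClassicalSolution ε C F a' t₀) {t : ℝ} (ht : t₀ < t) :
    ∃ w : ℝ → ℝ,
      (∀ x ∈ Icc (0:ℝ) π, HasDerivWithinAt (fun y => S.ut y t) (w x) (Icc 0 π) x) ∧
      (∀ x ∈ Icc (0:ℝ) π, HasDerivWithinAt w (S.uxxt x t) (Icc 0 π) x) := by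
  have hpi := pi_pos
  have hπm : π ∈ Icc (0:ℝ) π := ⟨hpi.le, le_rfl⟩
  have hJ : ∀ x ∈ Icc (0:ℝ) π, HasDerivAt (fun s => ∫ y in (0:ℝ)..x, (x - y) * S.uxx y s)
      (∫ y in (0:ℝ)..x, (x - y) * S.uxxt y t) t := by
    intro x hx
    refine aux_param_deriv (f := fun y s => (x - y) * S.uxx y s)
      (f' := fun y s => (x - y) * S.uxxt y s) ?_ ?_ ?_ ht hx
    · exact ContinuousOn.mul (by fun_prop) S.cont_uxx
    · exact ContinuousOn.mul (by fun_prop) S.cont_uxxt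
    · intro y hy s hs
      exact (S.huxxt' y hy s hs).const_mul (x - y)
  have hrep : ∀ s, t₀ ≤ s → ∀ x ∈ Icc (0:ℝ) π,
      S.u x s = x * S.ux 0 s + ∫ y in (0:ℝ)..x, (x - y) * S.uxx y s := by
    intro s hs
    exact aux_rep (S.hux s hs) (S.huxx s hs) (aux_slice S.cont_uxx hs) (S.bc0 s hs)
  have hrep2 : ∀ s, t₀ ≤ s → ∀ x ∈ Icc (0:ℝ) π,
      S.u x s = x * (-(∫ y in (0:ℝ)..π, (π - y) * S.uxx y s) / π)
        + ∫ y in (0:ℝ)..x, (x - y) * S.uxx y s := by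
    intro s hs x hx
    have h1 := hrep s hs π hπm
    rw [S.bcπ s hs] at h1
    rw [hrep s hs x hx]
    congr 2
    field_simp
    linarith
  set c : ℝ := -(∫ y in (0:ℝ)..π, (π - y) * S.uxxt y t) / π with hc
  have hkc : ContinuousOn (fun y => S.uxxt y t) (Icc 0 π) := aux_slice S.cont_uxxt ht.le
  have hut : ∀ x ∈ Icc (0:ℝ) π,
      S.ut x t = x * c + (x * (∫ y in (0:ℝ)..x, S.uxxt y t) - ∫ y in (0:ℝ)..x, y * S.uxxt y t) := by
    intro x hx
    have h1 := (((hJ π hπm).neg.div_const π).const_mul x).add (hJ x hx)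
    have h2 : S.ut x t = x * c + ∫ y in (0:ℝ)..x, (x - y) * S.uxxt y t := by
      refine (S.hut' x hx t ht).unique (h1.congr_of_eventuallyEq ?_)
      filter_upwards [lt_mem_nhds ht] with s hs
      exact hrep2 s hs.le x hx
    have hsub : Icc 0 x ⊆ Icc (0:ℝ) π := Icc_subset_Icc_right hx.2
    have hk1 := hkc.mono hsub
    rw [h2, ← intervalIntegral.integral_const_mul, ← intervalIntegral.integral_sub]
    · congr 1
      apply intervalIntegral.integral_congr
      intro y _
      ring
    · exact ContinuousOn.intervalIntegrable_of_Icc hx.1 (by fun_prop)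
    · exact ContinuousOn.intervalIntegrable_of_Icc hx.1 (by fun_prop)
  refine ⟨fun x => c + ∫ y in (0:ℝ)..x, S.uxxt y t, ?_, ?_⟩
  · intro x hx
    have e1 := aux_ftc hkc x hx
    have e2 := aux_ftc (h := fun y => y * S.uxxt y t) (by fun_prop) x hx
    have e3 := hasDerivWithinAt_id x (Icc 0 π)
    have e4 := (e3.mul_const c).fun_add ((e3.fun_mul e1).fun_sub e2)
    refine (e4.congr hut (hut x hx)).congr_deriv ?_
    simp only [id]
    ring
  · intro x hx
    exact (aux_ftc hkc x hx).const_add c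

end sol

/-! ### Quadratic forms -/

lemma aux_quad {f g : ℝ → ℝ} (hf : ContinuousOn f (Icc 0 π)) (hg : ContinuousOn g (Icc 0 π))
    (α β : ℝ) :
    0 ≤ α ^ 2 * (∫ x in (0:ℝ)..π, f x ^ 2) + 2 * α * β * (∫ x in (0:ℝ)..π, f x * g x)
      + β ^ 2 * ∫ x in (0:ℝ)..π, g x ^ 2 := by
  have h : 0 ≤ ∫ x in (0:ℝ)..π, (α * f x + β * g x) ^ 2 :=
    intervalIntegral.integral_nonneg pi_pos.le (fun x _ => sq_nonneg _)
  have e : (∫ x in (0:ℝ)..π, (α * f x + β * g x) ^ 2) =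
      ∫ x in (0:ℝ)..π, (α ^ 2 * f x ^ 2 + 2 * α * β * (f x * g x) + β ^ 2 * g x ^ 2) := by
    congr 1; ext x; ring
  rw [e, intervalIntegral.integral_add (aux_ii (by fun_prop)) (aux_ii (by fun_prop)),
    intervalIntegral.integral_add (aux_ii (by fun_prop)) (aux_ii (by fun_prop)),
    intervalIntegral.integral_const_mul, intervalIntegral.integral_const_mul,
    intervalIntegral.integral_const_mul] at h
  exact h

lemma aux_damp {a f g : ℝ → ℝ} (ha : ContinuousOn a (Icc 0 π))
    (hf : ContinuousOn f (Icc 0 π)) (hg : ContinuousOn g (Icc 0 π)) {A c : ℝ} (hc : 0 < c)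
    (ha0 : ∀ x ∈ Icc (0:ℝ) π, 0 ≤ a x) (haA : ∀ x ∈ Icc (0:ℝ) π, a x ≤ A) (e : ℝ) :
    e * (∫ x in (0:ℝ)..π, g x * (a x * f x)) ≤ c * (e ^ 2 * ∫ x in (0:ℝ)..π, g x ^ 2)
      + A ^ 2 / (4 * c) * ∫ x in (0:ℝ)..π, f x ^ 2 := by
  rw [← intervalIntegral.integral_const_mul, ← mul_assoc, ← intervalIntegral.integral_const_mul,
    ← intervalIntegral.integral_const_mul, ← intervalIntegral.integral_add
      (aux_ii (by fun_prop)) (aux_ii (by fun_prop))]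
  apply intervalIntegral.integral_mono_on pi_pos.le (aux_ii (by fun_prop)) (aux_ii (by fun_prop))
  intro x hx
  have h1 : a x ^ 2 ≤ A ^ 2 := pow_le_pow_left₀ (ha0 x hx) (haA x hx) 2
  have h2 : a x ^ 2 / (4 * c) * f x ^ 2 ≤ A ^ 2 / (4 * c) * f x ^ 2 := by gcongr
  refine le_trans ?_ (add_le_add_right h2 _)
  have h3 : c * e ^ 2 * g x ^ 2 + a x ^ 2 / (4 * c) * f x ^ 2 - e * (g x * (a x * f x)) =
      c * (e * g x - a x * f x / (2 * c)) ^ 2 := by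
    field_simp; ring
  nlinarith [mul_nonneg hc.le (sq_nonneg (e * g x - a x * f x / (2 * c)))]

/-! ### The energy quantities -/

section energy
variable {ε C F : ℝ → ℝ} {a' t₀ : ℝ}

noncomputable def qY (S : ClassicalSolution ε C F a' t₀) (t : ℝ) : ℝ :=
  ∫ x in (0:ℝ)..π, S.ut x t ^ 2
noncomputable def qX (S : ClassicalSolution ε C F a' t₀) (t : ℝ) : ℝ :=
  ∫ x in (0:ℝ)..π, S.ux x t ^ 2
noncomputable def qU (S : ClassicalSolution ε C F a' t₀) (t : ℝ) : ℝ :=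
  ∫ x in (0:ℝ)..π, S.u x t ^ 2
noncomputable def qP (S : ClassicalSolution ε C F a' t₀) (t : ℝ) : ℝ :=
  ∫ x in (0:ℝ)..π, S.uxx x t ^ 2
noncomputable def qB (S : ClassicalSolution ε C F a' t₀) (t : ℝ) : ℝ :=
  ∫ x in (0:ℝ)..π, S.uxx x t * S.ut x t
noncomputable def qM (S : ClassicalSolution ε C F a' t₀) (t : ℝ) : ℝ :=
  ∫ x in (0:ℝ)..π, S.u x t * S.ut x t
noncomputable def qPhi (S : ClassicalSolution ε C F a' t₀) (Ψ : ℝ → ℝ) (t : ℝ) : ℝ :=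
  ∫ x in (0:ℝ)..π, Ψ (S.u x t)

/-- The square of `d`. -/
noncomputable def qD (S : ClassicalSolution ε C F a' t₀) (t : ℝ) : ℝ :=
  ε t ^ 2 * qP S t + qX S t + qU S t + qY S t

/-- The Liapunov functional. -/
noncomputable def qV (S : ClassicalSolution ε C F a' t₀) (ε' Ψ : ℝ → ℝ) (γ θ : ℝ) (t : ℝ) : ℝ :=
  γ * (qY S t / 2 + C t * qX S t / 2 - qPhi S Ψ t)
    + (qY S t - 2 * (ε t * qB S t) + ε t ^ 2 * qP S t) / 2
    + (C t - ε' t + a' * ε t) * qX S t / 2 - qPhi S Ψ t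
    + θ * (qM S t + ε t * qX S t / 2 + a' * qU S t / 2)

lemma cU (S : ClassicalSolution ε C F a' t₀) :
    ContinuousOn (fun p : ℝ × ℝ => S.u p.1 p.2) (Icc 0 π ×ˢ Ici t₀) := S.cont_u
lemma cUx (S : ClassicalSolution ε C F a' t₀) :
    ContinuousOn (fun p : ℝ × ℝ => S.ux p.1 p.2) (Icc 0 π ×ˢ Ici t₀) := S.cont_ux
lemma cUxx (S : ClassicalSolution ε C F a' t₀) :
    ContinuousOn (fun p : ℝ × ℝ => S.uxx p.1 p.2) (Icc 0 π ×ˢ Ici t₀) := S.cont_uxx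
lemma cUt (S : ClassicalSolution ε C F a' t₀) :
    ContinuousOn (fun p : ℝ × ℝ => S.ut p.1 p.2) (Icc 0 π ×ˢ Ici t₀) := S.cont_ut
lemma cUtt (S : ClassicalSolution ε C F a' t₀) :
    ContinuousOn (fun p : ℝ × ℝ => S.utt p.1 p.2) (Icc 0 π ×ˢ Ici t₀) := S.cont_utt
lemma cUxxt (S : ClassicalSolution ε C F a' t₀) :
    ContinuousOn (fun p : ℝ × ℝ => S.uxxt p.1 p.2) (Icc 0 π ×ˢ Ici t₀) := S.cont_uxxt

lemma q_cont (S : ClassicalSolution ε C F a' t₀) {Ψ : ℝ → ℝ} (hΨ : Continuous Ψ) :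
    ContinuousOn (qY S) (Ici t₀) ∧ ContinuousOn (qX S) (Ici t₀) ∧ ContinuousOn (qU S) (Ici t₀) ∧
    ContinuousOn (qP S) (Ici t₀) ∧ ContinuousOn (qB S) (Ici t₀) ∧ ContinuousOn (qM S) (Ici t₀) ∧
    ContinuousOn (qPhi S Ψ) (Ici t₀) := by
  have h1 := cU S
  have h2 := cUx S
  have h3 := cUxx S
  have h4 := cUt S
  refine ⟨aux_param_cont (h4.pow 2), aux_param_cont (h2.pow 2), aux_param_cont (h1.pow 2),
    aux_param_cont (h3.pow 2), aux_param_cont (h3.mul h4), aux_param_cont (h1.mul h4),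
    aux_param_cont (hΨ.comp_continuousOn h1)⟩

lemma qD_eq (S : ClassicalSolution ε C F a' t₀) {t : ℝ} (ht : t₀ ≤ t) :
    qD S t = ∫ x in (0:ℝ)..π,
      ((ε t)^2 * (S.uxx x t)^2 + (S.ux x t)^2 + (S.u x t)^2 + (S.ut x t)^2) := by
  have h1 := aux_slice S.cont_u ht
  have h2 := aux_slice S.cont_ux ht
  have h3 := aux_slice S.cont_uxx ht
  have h4 := aux_slice S.cont_ut ht
  rw [intervalIntegral.integral_add (aux_ii (by fun_prop)) (aux_ii (by fun_prop)),
    intervalIntegral.integral_add (aux_ii (by fun_prop)) (aux_ii (by fun_prop)),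
    intervalIntegral.integral_add (aux_ii (by fun_prop)) (aux_ii (by fun_prop)),
    intervalIntegral.integral_const_mul]
  rfl

lemma q_nonneg (S : ClassicalSolution ε C F a' t₀) (t : ℝ) :
    0 ≤ qY S t ∧ 0 ≤ qX S t ∧ 0 ≤ qU S t ∧ 0 ≤ qP S t :=
  ⟨intervalIntegral.integral_nonneg pi_pos.le (fun _ _ => sq_nonneg _),
   intervalIntegral.integral_nonneg pi_pos.le (fun _ _ => sq_nonneg _),
   intervalIntegral.integral_nonneg pi_pos.le (fun _ _ => sq_nonneg _),
   intervalIntegral.integral_nonneg pi_pos.le (fun _ _ => sq_nonneg _)⟩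

lemma qU_le (S : ClassicalSolution ε C F a' t₀) {t : ℝ} (ht : t₀ ≤ t) : qU S t ≤ qX S t :=
  aux_poincare (S.hux t ht) (aux_slice S.cont_ux ht) (S.bc0 t ht) (S.bcπ t ht)

lemma qX_eq (S : ClassicalSolution ε C F a' t₀) {t : ℝ} (ht : t₀ ≤ t) :
    qX S t = - ∫ x in (0:ℝ)..π, S.u x t * S.uxx x t := by
  rw [aux_ibp (S.hux t ht) (S.huxx t ht) (aux_slice S.cont_ux ht) (aux_slice S.cont_uxx ht)
    (S.bc0 t ht) (S.bcπ t ht), neg_neg]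
  simp only [qX, sq]

/-- Testing the equation. -/
lemma pde_test (S : ClassicalSolution ε C F a' t₀) (hF : Continuous F) {t : ℝ} (ht : t₀ < t)
    {w : ℝ → ℝ} (hw : ContinuousOn w (Icc 0 π)) :
    ∫ x in (0:ℝ)..π, w x * S.utt x t =
      ε t * (∫ x in (0:ℝ)..π, w x * S.uxxt x t) + C t * (∫ x in (0:ℝ)..π, w x * S.uxx x t)
      - a' * (∫ x in (0:ℝ)..π, w x * S.ut x t) + (∫ x in (0:ℝ)..π, w x * F (S.u x t))
      - ∫ x in (0:ℝ)..π, w x * (S.aa x t * S.ut x t) := by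
  have h1 := aux_slice S.cont_u ht.le
  have h3 := aux_slice S.cont_uxx ht.le
  have h4 := aux_slice S.cont_ut ht.le
  have h5 := aux_slice S.cont_uxxt ht.le
  have h6 := aux_slice S.cont_aa ht.le
  have h7 : ContinuousOn (fun x => F (S.u x t)) (Icc 0 π) := hF.comp_continuousOn h1
  have e : ∫ x in (0:ℝ)..π, w x * S.utt x t = ∫ x in (0:ℝ)..π,
      (ε t * (w x * S.uxxt x t) + C t * (w x * S.uxx x t) - a' * (w x * S.ut x t)
        + w x * F (S.u x t) - w x * (S.aa x t * S.ut x t)) := by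
    apply intervalIntegral.integral_congr_Ioo_of_le pi_pos.le
    intro x hx
    have := S.pde x hx t ht
    simp only
    linear_combination w x * this
  rw [e, intervalIntegral.integral_sub (aux_ii (by fun_prop)) (aux_ii (by fun_prop)),
    intervalIntegral.integral_add (aux_ii (by fun_prop)) (aux_ii (by fun_prop)),
    intervalIntegral.integral_sub (aux_ii (by fun_prop)) (aux_ii (by fun_prop)),
    intervalIntegral.integral_add (aux_ii (by fun_prop)) (aux_ii (by fun_prop)),
    intervalIntegral.integral_const_mul, intervalIntegral.integral_const_mul,
    intervalIntegral.integral_const_mul]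

lemma qV_deriv (S : ClassicalSolution ε C F a' t₀) {ε' ε'' C' F' Ψ : ℝ → ℝ} {γ θ t A k : ℝ}
    (hFd : ∀ z, HasDerivAt F (F' z) z) (hF'c : Continuous F') (hF0 : F 0 = 0)
    (hΨ : ∀ z, HasDerivAt Ψ (F z) z)
    (ht : t₀ < t) (hε : HasDerivAt ε (ε' t) t) (hε' : HasDerivAt ε' (ε'' t) t)
    (hC : HasDerivAt C (C' t) t)
    (haA : ∀ x ∈ Icc (0:ℝ) π, S.aa x t ≤ A)
    (hF'k : ∀ x ∈ Icc (0:ℝ) π, F' (S.u x t) ≤ k)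
    (hFk : ∀ x ∈ Icc (0:ℝ) π, S.u x t * F (S.u x t) ≤ k * S.u x t ^ 2) :
    ∃ N R1 R2 R3 T H : ℝ, qY S t ≤ N ∧ 0 ≤ R1 ∧
      (∀ c, 0 < c → ε t * R2 ≤ c * (ε t ^ 2 * qP S t) + A ^ 2 / (4 * c) * qY S t) ∧
      (∀ c, 0 < c → - R3 ≤ c * qU S t + A ^ 2 / (4 * c) * qY S t) ∧
      T ≤ k * qX S t ∧ H ≤ k * qU S t ∧
      HasDerivAt (qV S ε' Ψ γ θ)
        (-γ * (ε t * N + a' * qY S t + R1) + γ * C' t * qX S t / 2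
          - ε t * (C t - ε' t) * qP S t - a' * qY S t - R1 + ε t * R2
          + (C' t - ε'' t + a' * ε' t) * qX S t / 2 + ε t * T
          + θ * (qY S t - (C t - ε' t / 2) * qX S t - R3 + H)) t := by
  have hFc : Continuous F := continuous_iff_continuousAt.2 fun z => (hFd z).continuousAt
  have hΨc : Continuous Ψ := continuous_iff_continuousAt.2 fun z => (hΨ z).continuousAt
  have h1 := aux_slice S.cont_u ht.le
  have h2 := aux_slice S.cont_ux ht.le
  have h3 := aux_slice S.cont_uxx ht.le
  have h4 := aux_slice S.cont_ut ht.le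
  have h5 := aux_slice S.cont_uxxt ht.le
  have h6 := aux_slice S.cont_aa ht.le
  have h8 := aux_slice S.cont_utt ht.le
  have h7 : ContinuousOn (fun x => F (S.u x t)) (Icc 0 π) := hFc.comp_continuousOn h1
  have h9 : ContinuousOn (fun x => F' (S.u x t)) (Icc 0 π) := hF'c.comp_continuousOn h1
  have c1 := cU S
  have c3 := cUxx S
  have c4 := cUt S
  have c5 := cUxxt S
  have c8 := cUtt S
  have c7 : ContinuousOn (fun p : ℝ × ℝ => F (S.u p.1 p.2)) (Icc 0 π ×ˢ Ici t₀) :=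
    hFc.comp_continuousOn c1
  have hπm : π ∈ Icc (0:ℝ) π := ⟨pi_pos.le, le_rfl⟩
  have ha0 : ∀ x ∈ Icc (0:ℝ) π, 0 ≤ S.aa x t := fun x hx => S.aa_nonneg x hx t ht.le
  obtain ⟨w, hw1, hw2⟩ := S.exists_uxt ht
  have hwc := aux_icc_cont hw2
  obtain ⟨hb0, hbπ⟩ := S.ut_boundary ht
  have b0 := S.bc0 t ht.le
  have bπ := S.bcπ t ht.le
  -- integration by parts identities
  have iN : ∫ x in (0:ℝ)..π, S.ut x t * S.uxxt x t = - ∫ x in (0:ℝ)..π, w x ^ 2 := by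
    rw [aux_ibp hw1 hw2 hwc h5 hb0 hbπ]
    simp only [sq]
  have iB : ∫ x in (0:ℝ)..π, S.u x t * S.uxxt x t = qB S t := by
    rw [aux_ibp (S.hux t ht.le) hw2 h2 h5 b0 bπ]
    have := aux_ibp hw1 (S.huxx t ht.le) hwc h3 hb0 hbπ
    have e1 : qB S t = ∫ x in (0:ℝ)..π, S.ut x t * S.uxx x t := by
      simp only [qB, mul_comm]
    rw [e1, this]
    simp only [mul_comm]
  have iT : ∫ x in (0:ℝ)..π, F (S.u x t) * S.uxx x t
      = - ∫ x in (0:ℝ)..π, F' (S.u x t) * S.ux x t ^ 2 := by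
    have e1 : ∀ x ∈ Icc (0:ℝ) π, HasDerivWithinAt (fun x => F (S.u x t))
        (F' (S.u x t) * S.ux x t) (Icc 0 π) x := by
      intro x hx
      exact (hFd (S.u x t)).comp_hasDerivWithinAt x (S.hux t ht.le x hx)
    rw [aux_ibp e1 (S.huxx t ht.le) (h9.mul h2) h3 (by simp only [b0, hF0])
      (by simp only [bπ, hF0])]
    congr 2
    ext x
    ring
  -- derivatives of the components
  have dY : HasDerivAt (qY S) (2 * ∫ x in (0:ℝ)..π, S.ut x t * S.utt x t) t := by
    have := aux_param_deriv (f := fun x s => S.ut x s ^ 2)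
      (f' := fun x s => 2 * (S.ut x s * S.utt x s)) (c4.fun_pow 2)
      (ContinuousOn.mul (by fun_prop) (c4.mul c8))
      (fun x hx s hs => ((S.hutt' x hx s hs).fun_pow 2).congr_deriv (by push_cast; ring)) ht hπm
    rw [intervalIntegral.integral_const_mul] at this
    exact this
  have dP : HasDerivAt (qP S) (2 * ∫ x in (0:ℝ)..π, S.uxx x t * S.uxxt x t) t := by
    have := aux_param_deriv (f := fun x s => S.uxx x s ^ 2)
      (f' := fun x s => 2 * (S.uxx x s * S.uxxt x s)) (c3.fun_pow 2)
      (ContinuousOn.mul (by fun_prop) (c3.mul c5))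
      (fun x hx s hs => ((S.huxxt' x hx s hs).fun_pow 2).congr_deriv (by push_cast; ring)) ht hπm
    rw [intervalIntegral.integral_const_mul] at this
    exact this
  have dU : HasDerivAt (qU S) (2 * qM S t) t := by
    have := aux_param_deriv (f := fun x s => S.u x s ^ 2)
      (f' := fun x s => 2 * (S.u x s * S.ut x s)) (c1.fun_pow 2)
      (ContinuousOn.mul (by fun_prop) (c1.mul c4))
      (fun x hx s hs => ((S.hut' x hx s hs).fun_pow 2).congr_deriv (by push_cast; ring)) ht hπm
    rw [intervalIntegral.integral_const_mul] at this
    exact this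
  have dB : HasDerivAt (qB S) ((∫ x in (0:ℝ)..π, S.ut x t * S.uxxt x t)
      + ∫ x in (0:ℝ)..π, S.uxx x t * S.utt x t) t := by
    have := aux_param_deriv (f := fun x s => S.uxx x s * S.ut x s)
      (f' := fun x s => S.ut x s * S.uxxt x s + S.uxx x s * S.utt x s) (c3.mul c4)
      ((c4.mul c5).add (c3.mul c8))
      (fun x hx s hs => ((S.huxxt' x hx s hs).fun_mul (S.hutt' x hx s hs)).congr_deriv (by ring))
      ht hπm
    rw [intervalIntegral.integral_add (aux_ii (by fun_prop)) (aux_ii (by fun_prop))] at this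
    exact this
  have dM : HasDerivAt (qM S) (qY S t + ∫ x in (0:ℝ)..π, S.u x t * S.utt x t) t := by
    have := aux_param_deriv (f := fun x s => S.u x s * S.ut x s)
      (f' := fun x s => S.ut x s ^ 2 + S.u x s * S.utt x s) (c1.mul c4)
      ((c4.fun_pow 2).fun_add (c1.mul c8))
      (fun x hx s hs => ((S.hut' x hx s hs).fun_mul (S.hutt' x hx s hs)).congr_deriv (by ring))
      ht hπm
    rw [intervalIntegral.integral_add (aux_ii (by fun_prop)) (aux_ii (by fun_prop))] at this
    exact this
  have dPhi : HasDerivAt (qPhi S Ψ) (∫ x in (0:ℝ)..π, S.ut x t * F (S.u x t)) t := by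
    exact aux_param_deriv (f := fun x s => Ψ (S.u x s))
      (f' := fun x s => S.ut x s * F (S.u x s)) (hΨc.comp_continuousOn c1)
      (c4.mul c7)
      (fun x hx s hs => ((hΨ (S.u x s)).comp s (S.hut' x hx s hs)).congr_deriv (by ring))
      ht hπm
  have dX : HasDerivAt (qX S) (-2 * qB S t) t := by
    have := aux_param_deriv (f := fun x s => S.u x s * S.uxx x s)
      (f' := fun x s => S.uxx x s * S.ut x s + S.u x s * S.uxxt x s) (c1.mul c3)
      ((c3.mul c4).add (c1.mul c5))
      (fun x hx s hs => ((S.hut' x hx s hs).fun_mul (S.huxxt' x hx s hs)).congr_deriv (by ring))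
      ht hπm
    rw [intervalIntegral.integral_add (aux_ii (by fun_prop)) (aux_ii (by fun_prop)), iB] at this
    have e2 := this.fun_neg.congr_of_eventuallyEq (f₁ := qX S) (by
      filter_upwards [lt_mem_nhds ht] with s hs
      exact qX_eq S hs.le)
    refine e2.congr_deriv ?_
    change -(qB S t + qB S t) = _
    ring
  have hXX : (∫ x in (0:ℝ)..π, S.u x t * S.uxx x t) = - qX S t := by
    rw [qX_eq S ht.le, neg_neg]
  have p1 := pde_test S hFc ht h4
  have p2 := pde_test S hFc ht h3
  have p3 := pde_test S hFc ht h1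
  have eB : (∫ x in (0:ℝ)..π, S.ut x t * S.uxx x t) = qB S t := by
    simp only [qB, mul_comm]
  have eY : (∫ x in (0:ℝ)..π, S.ut x t * S.ut x t) = qY S t := by
    simp only [qY, sq]
  have eP : (∫ x in (0:ℝ)..π, S.uxx x t * S.uxx x t) = qP S t := by
    simp only [qP, sq]
  have eB' : (∫ x in (0:ℝ)..π, S.uxx x t * S.ut x t) = qB S t := rfl
  have eM : (∫ x in (0:ℝ)..π, S.u x t * S.ut x t) = qM S t := rfl
  have eT : (∫ x in (0:ℝ)..π, S.uxx x t * F (S.u x t))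
      = - ∫ x in (0:ℝ)..π, F' (S.u x t) * S.ux x t ^ 2 := by
    rw [← iT]; simp only [mul_comm]
  rw [iN, eB, eY] at p1
  rw [eP, eB', eT] at p2
  rw [iB, hXX, eM] at p3
  rw [iN] at dB
  refine ⟨∫ x in (0:ℝ)..π, w x ^ 2, ∫ x in (0:ℝ)..π, S.ut x t * (S.aa x t * S.ut x t),
    ∫ x in (0:ℝ)..π, S.uxx x t * (S.aa x t * S.ut x t),
    ∫ x in (0:ℝ)..π, S.u x t * (S.aa x t * S.ut x t),
    ∫ x in (0:ℝ)..π, F' (S.u x t) * S.ux x t ^ 2,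
    ∫ x in (0:ℝ)..π, S.u x t * F (S.u x t), ?_, ?_, ?_, ?_, ?_, ?_, ?_⟩
  · exact aux_poincare hw1 hwc hb0 hbπ
  · apply intervalIntegral.integral_nonneg pi_pos.le
    intro x hx
    have := mul_nonneg (ha0 x hx) (sq_nonneg (S.ut x t))
    nlinarith
  · intro c hc
    exact aux_damp h6 h4 h3 hc ha0 haA (ε t)
  · intro c hc
    have := aux_damp h6 h4 h1 hc ha0 haA (-1)
    rw [neg_one_mul, neg_one_sq, one_mul] at this
    exact this
  · rw [qX, ← intervalIntegral.integral_const_mul]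
    apply intervalIntegral.integral_mono_on pi_pos.le (aux_ii (by fun_prop)) (aux_ii (by fun_prop))
    intro x hx
    exact mul_le_mul_of_nonneg_right (hF'k x hx) (sq_nonneg _)
  · rw [qU, ← intervalIntegral.integral_const_mul]
    apply intervalIntegral.integral_mono_on pi_pos.le (aux_ii (by fun_prop)) (aux_ii (by fun_prop))
    intro x hx
    exact hFk x hx
  · have d1 := (((dY.div_const 2).fun_add ((hC.fun_mul dX).div_const 2)).fun_sub dPhi).const_mul γ
    have d2 := ((dY.fun_sub ((hε.fun_mul dB).const_mul 2)).fun_add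
      ((hε.fun_pow 2).fun_mul dP)).div_const 2
    have d3 := (((hC.fun_sub hε').fun_add (hε.const_mul a')).fun_mul dX).div_const 2
    have d4 := ((dM.fun_add ((hε.fun_mul dX).div_const 2)).fun_add
      ((dU.const_mul a').div_const 2)).const_mul θ
    have d5 := (((d1.fun_add d2).fun_add d3).fun_sub dPhi).fun_add d4
    refine HasDerivAt.congr_deriv (f := qV S ε' Ψ γ θ) d5 ?_
    rw [p1, p2, p3]
    push_cast
    ring

end energy

/-! ### Bounds for the Liapunov functional -/

section bounds
variable {ε C F : ℝ → ℝ} {a' t₀ : ℝ}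

lemma qV_lower (S : ClassicalSolution ε C F a' t₀) {ε' Ψ : ℝ → ℝ} {γ θ t k μ m Cbar : ℝ}
    (ht : t₀ ≤ t) (hk : 0 ≤ k) (hC : Cbar ≤ C t) (hCk : k ≤ Cbar) (hμ : 0 < μ)
    (hdiss : μ * (1 + ε t) ≤ C t - ε' t) (hε : 0 ≤ ε t) (ha' : 0 ≤ a')
    (hm : m = μ + Cbar / 2 - 2 * k) (hm0 : 0 < m) (hθ : 0 ≤ θ) (hγ : 2 * (θ ^ 2 / m) + 2 ≤ γ)
    (hPhi : qPhi S Ψ t ≤ k / 2 * qU S t) :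
    min (1 / 4) (m / 8) * qD S t ≤ qV S ε' Ψ γ θ t := by
  obtain ⟨hY, hX, hU, hP⟩ := q_nonneg S t
  have hUX := qU_le S ht
  have h1 : 0 ≤ ε t ^ 2 * qP S t + 2 * ε t * (-2) * qB S t + (-2) ^ 2 * qY S t :=
    aux_quad (aux_slice S.cont_uxx ht) (aux_slice S.cont_ut ht) (ε t) (-2)
  have h2 : 0 ≤ (m / 2) ^ 2 * qU S t + 2 * (m / 2) * θ * qM S t + θ ^ 2 * qY S t :=
    aux_quad (aux_slice S.cont_u ht) (aux_slice S.cont_ut ht) (m / 2) θ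
  have h3 : 0 ≤ m / 4 * qU S t + θ * qM S t + θ ^ 2 / m * qY S t := by
    have e : m / 4 * qU S t + θ * qM S t + θ ^ 2 / m * qY S t =
        ((m / 2) ^ 2 * qU S t + 2 * (m / 2) * θ * qM S t + θ ^ 2 * qY S t) / m := by
      field_simp; ring
    rw [e]; exact div_nonneg h2 hm0.le
  have hθm : 0 ≤ θ ^ 2 / m := by positivity
  have hγ2 : 2 ≤ γ := by linarith
  have h4 : qPhi S Ψ t ≤ k / 2 * qX S t := hPhi.trans (by gcongr)
  have h5 : (Cbar - k) / 4 * qX S t ≤ γ * (C t * qX S t / 2 - qPhi S Ψ t) := by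
    have e1 : (Cbar - k) / 2 * qX S t ≤ C t * qX S t / 2 - qPhi S Ψ t := by
      nlinarith [mul_le_mul_of_nonneg_right hC hX]
    have e2 : 0 ≤ (Cbar - k) / 2 * qX S t := mul_nonneg (by linarith) hX
    nlinarith [mul_le_mul_of_nonneg_right hγ2 (e2.trans e1)]
  have h6 : (μ - k) / 2 * qX S t ≤ (C t - ε' t + a' * ε t) * qX S t / 2 - qPhi S Ψ t := by
    have e1 : μ ≤ C t - ε' t + a' * ε t := by nlinarith [mul_nonneg ha' hε, mul_nonneg hμ.le hε]
    nlinarith [mul_le_mul_of_nonneg_right e1 hX]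
  have h7 : 0 ≤ θ * (ε t * qX S t / 2 + a' * qU S t / 2) := by positivity
  have h8 : (θ ^ 2 / m + 1) * qY S t ≤ γ / 2 * qY S t := by gcongr; linarith
  have hZ : 0 ≤ ε t ^ 2 * qP S t := by positivity
  have h9 : qY S t / 2 + m / 4 * qX S t + ε t ^ 2 * qP S t / 4 ≤ qV S ε' Ψ γ θ t := by
    have hmX : m / 4 * qU S t ≤ m / 4 * qX S t := by gcongr
    have hmX2 : m / 2 * qX S t ≤ (Cbar - k) / 4 * qX S t + (μ - k) / 2 * qX S t := by
      rw [← add_mul]; gcongr; rw [hm]; linarith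
    unfold qV
    linarith
  refine le_trans ?_ h9
  unfold qD
  have m1 := min_le_left (1 / 4 : ℝ) (m / 8)
  have m2 := min_le_right (1 / 4 : ℝ) (m / 8)
  have n1 := mul_le_mul_of_nonneg_right m1 hZ
  have n2 := mul_le_mul_of_nonneg_right m1 hY
  have n3 := mul_le_mul_of_nonneg_right m2 hX
  have n4 := mul_le_mul_of_nonneg_right m2 hU
  have n5 : m / 8 * qU S t ≤ m / 8 * qX S t := by gcongr
  linarith

lemma qV_upper (S : ClassicalSolution ε C F a' t₀) {ε' Ψ : ℝ → ℝ} {γ θ t μ L : ℝ}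
    (ht : t₀ ≤ t) (hC : 0 ≤ C t) (hμ : 0 < μ)
    (hdiss : μ * (1 + ε t) ≤ C t - ε' t) (hε : 0 ≤ ε t) (ha' : 0 ≤ a')
    (hθ : 0 ≤ θ) (hγ : 0 ≤ γ) (hL : 0 ≤ L)
    (hPhi : - qPhi S Ψ t ≤ L / 2 * qU S t) :
    qV S ε' Ψ γ θ t ≤ (γ * (3 / 2 + L / 2) + 2 + a' / μ + L / 2 + θ * (1 + 1 / μ + a' / 2))
      * ((C t - ε' t / 2 + 1) * qD S t) := by
  obtain ⟨hY, hX, hU, hP⟩ := q_nonneg S t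
  have hZ : 0 ≤ ε t ^ 2 * qP S t := by positivity
  have h1 : 0 ≤ ε t ^ 2 * qP S t + 2 * ε t * 1 * qB S t + 1 ^ 2 * qY S t :=
    aux_quad (aux_slice S.cont_uxx ht) (aux_slice S.cont_ut ht) (ε t) 1
  have h2 : 0 ≤ 1 ^ 2 * qU S t + 2 * 1 * (-1) * qM S t + (-1) ^ 2 * qY S t :=
    aux_quad (aux_slice S.cont_u ht) (aux_slice S.cont_ut ht) 1 (-1)
  have hCe : 0 ≤ C t - ε' t := le_trans (by positivity) hdiss
  have hμe : 0 ≤ μ * ε t := by positivity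
  set D := qD S t with hD
  have hDX : qX S t ≤ D := by rw [hD, qD]; linarith
  have hDU : qU S t ≤ D := by rw [hD, qD]; linarith
  have hDY : qY S t ≤ D := by rw [hD, qD]; linarith
  have hDZ : qY S t + ε t ^ 2 * qP S t ≤ D := by rw [hD, qD]; linarith
  have hD0 : 0 ≤ D := hX.trans hDX
  have hDUY : qU S t + qY S t ≤ D := by rw [hD, qD]; linarith
  set g := C t - ε' t / 2 + 1 with hg
  have hg1 : 1 ≤ g := by rw [hg]; linarith
  have hG : D ≤ g * D := by nlinarith
  set G := g * D with hGdef
  have k1 : C t * qX S t ≤ 2 * G := by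
    calc C t * qX S t ≤ (2 * g) * D := by
          apply mul_le_mul _ hDX hX (by linarith)
          rw [hg]; linarith
      _ = _ := by ring
  have k2 : (C t - ε' t) * qX S t ≤ 2 * G := by
    calc (C t - ε' t) * qX S t ≤ (2 * g) * D := by
          apply mul_le_mul _ hDX hX (by linarith)
          rw [hg]; linarith
      _ = _ := by ring
  have k3 : ε t * qX S t ≤ 2 * (1 / μ) * G := by
    calc ε t * qX S t ≤ (2 * (1 / μ) * g) * D := by
          apply mul_le_mul _ hDX hX (by positivity)
          rw [mul_assoc, ← mul_div_right_comm, one_mul, ← mul_div_assoc, le_div_iff₀ hμ]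
          nlinarith
      _ = _ := by ring
  have hLU : L / 2 * qU S t ≤ L / 2 * G := by gcongr; linarith
  have s1 : γ * (qY S t / 2 + C t * qX S t / 2 - qPhi S Ψ t) ≤ γ * ((3 / 2 + L / 2) * G) := by
    gcongr; linarith
  have s2 : (qY S t - 2 * (ε t * qB S t) + ε t ^ 2 * qP S t) / 2 ≤ G := by linarith
  have s3 : (C t - ε' t + a' * ε t) * qX S t / 2 ≤ G + a' / μ * G := by
    have := mul_le_mul_of_nonneg_left k3 ha'
    have e : a' / μ * G = a' * (1 / μ * G) := by ring
    rw [e]; linarith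
  have s4 : θ * (qM S t + ε t * qX S t / 2 + a' * qU S t / 2)
      ≤ θ * ((1 + 1 / μ + a' / 2) * G) := by
    gcongr
    have := mul_le_mul_of_nonneg_left (hDU.trans hG) ha'
    linarith
  unfold qV
  linarith

set_option maxHeartbeats 2000000 in
lemma deriv_bound {γ θ μ m k lam Cbar A eb a' e e1 e2 c c1 X Y U P N R1 R2 R3 T H : ℝ}
    (hk : 0 ≤ k) (hC : Cbar ≤ c) (hCb : 0 < Cbar) (hμ : 0 < μ) (hm0 : 0 < m)
    (hm : m = μ + Cbar / 2 - 2 * k) (ha' : 0 ≤ a') (he : 0 ≤ e)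
    (hdiss : μ * (1 + e) ≤ c - e1) (hlam : lam ≤ a' + e)
    (he2 : eb ≤ e2) (hθ0 : 0 ≤ θ) (hγ0 : 0 ≤ γ) (hc1 : (1 + γ) * c1 ≤ 1)
    (hθ1 : 2 * a' ≤ θ) (hθ2 : 2 * k ≤ θ * μ) (hθ3 : |eb| / 2 + 1 ≤ θ * (m / 4))
    (hγ : A ^ 2 / (4 * (μ / 2)) + θ + θ * (A ^ 2 / (4 * (m / 4))) + 1 ≤ γ * lam)
    (hX : 0 ≤ X) (hY : 0 ≤ Y) (hP : 0 ≤ P) (hUX : U ≤ X)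
    (hN : Y ≤ N) (hR1 : 0 ≤ R1)
    (hR2 : e * R2 ≤ (μ / 2) * (e ^ 2 * P) + A ^ 2 / (4 * (μ / 2)) * Y)
    (hR3 : - R3 ≤ (m / 4) * U + A ^ 2 / (4 * (m / 4)) * Y)
    (hT : T ≤ k * X) (hH : H ≤ k * U) :
    -γ * (e * N + a' * Y + R1) + γ * c1 * X / 2 - e * (c - e1) * P - a' * Y - R1 + e * R2
      + (c1 - e2 + a' * e1) * X / 2 + e * T + θ * (Y - (c - e1 / 2) * X - R3 + H)
      ≤ - min (μ / 2) (1 / 4) * (e ^ 2 * P + X + U + Y) := by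
  have t1 : γ * lam * Y ≤ γ * (e * N + a' * Y + R1) := by
    have : lam * Y ≤ e * N + a' * Y + R1 := by
      nlinarith [mul_le_mul_of_nonneg_left hN he, mul_le_mul_of_nonneg_right hlam hY]
    nlinarith [mul_le_mul_of_nonneg_left this hγ0]
  have t2 : 0 ≤ a' * Y := by positivity
  have t3 : μ * (e ^ 2 * P) ≤ e * (c - e1) * P := by
    have h1 : μ * e ≤ c - e1 := by linarith
    have h2 := mul_le_mul_of_nonneg_left h1 he
    have h3 := mul_le_mul_of_nonneg_right h2 hP
    nlinarith
  have t4 : e * T ≤ e * (k * X) := mul_le_mul_of_nonneg_left hT he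
  have hmU : m / 4 * U ≤ m / 4 * X := by gcongr
  have hkU : k * U ≤ k * X := by gcongr
  have t5 : θ * (Y - (c - e1 / 2) * X - R3 + H) ≤
      θ * (Y + A ^ 2 / (4 * (m / 4)) * Y) - θ * (c / 4 + m / 4 + μ * e / 2) * X := by
    have h1 : (c / 4 + m / 4 + μ * e / 2) + m / 4 + k ≤ c - e1 / 2 := by rw [hm]; linarith
    have h2 := mul_le_mul_of_nonneg_right h1 hX
    have h3 : Y - (c - e1 / 2) * X - R3 + H ≤
        Y + A ^ 2 / (4 * (m / 4)) * Y - (c / 4 + m / 4 + μ * e / 2) * X := by linarith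
    have := mul_le_mul_of_nonneg_left h3 hθ0
    linarith
  have t6 : ((1 + γ) * c1 / 2 - e2 / 2 + a' * e1 / 2 + e * k
      - θ * (c / 4 + m / 4 + μ * e / 2)) * X ≤ - (1 / 2) * X := by
    apply mul_le_mul_of_nonneg_right _ hX
    have g1 : a' * e1 ≤ a' * c := by
      apply mul_le_mul_of_nonneg_left _ ha'
      nlinarith [mul_nonneg hμ.le he]
    have g2 : 2 * a' * c ≤ θ * c := mul_le_mul_of_nonneg_right hθ1 (by linarith)
    have g3 : 2 * k * e ≤ θ * μ * e := mul_le_mul_of_nonneg_right hθ2 he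
    have g4 := neg_abs_le eb
    linarith
  have t7 := mul_le_mul_of_nonneg_right hγ hY
  have hZ : 0 ≤ e ^ 2 * P := by positivity
  have n1 := mul_le_mul_of_nonneg_right (min_le_left (μ / 2) (1 / 4)) hZ
  have n2 := mul_le_mul_of_nonneg_right (min_le_right (μ / 2) (1 / 4)) hX
  have n3 := mul_le_mul_of_nonneg_right (min_le_right (μ / 2) (1 / 4)) hY
  have n4 : min (μ / 2) (1 / 4) * U ≤ min (μ / 2) (1 / 4) * X := by
    apply mul_le_mul_of_nonneg_left hUX
    apply le_min <;> linarith
  linarith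

end bounds

/-! ### Abstract Liapunov arguments -/

lemma lyap_stable {V D g : ℝ → ℝ} {t₀ c c0 K r : ℝ} (hc : 0 < c) (hc0 : 0 < c0)
    (hVc : ContinuousOn V (Ici t₀)) (hDc : ContinuousOn D (Ici t₀)) (hD0 : ∀ t, 0 ≤ D t)
    (hlow : ∀ t, t₀ ≤ t → D t ≤ r → c0 * D t ≤ V t)
    (hup : ∀ t, t₀ ≤ t → D t ≤ r → V t ≤ K * (g t * D t))
    (hder : ∀ t, t₀ < t → D t ≤ r → ∃ v, HasDerivAt V v t ∧ v ≤ - c * D t)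
    {σ : ℝ} (hσr : σ ≤ r) (h1 : D t₀ < σ) (h2 : K * (g t₀ * D t₀) < c0 * σ) :
    ∀ t, t₀ ≤ t → D t < σ := by
  intro T hT
  by_contra hcon
  push Not at hcon
  have hsub : Icc t₀ T ⊆ Ici t₀ := Icc_subset_Ici_self
  have hcl : IsClosed (Icc t₀ T ∩ D ⁻¹' Ici σ) :=
    (hDc.mono hsub).preimage_isClosed_of_isClosed isClosed_Icc isClosed_Ici
  have hcomp : IsCompact (Icc t₀ T ∩ D ⁻¹' Ici σ) :=
    isCompact_Icc.of_isClosed_subset hcl inter_subset_left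
  obtain ⟨t1, ⟨⟨ht1, ht1T⟩, hDt1⟩, hmin⟩ := hcomp.exists_isLeast ⟨T, ⟨hT, le_rfl⟩, hcon⟩
  have hDt1 : σ ≤ D t1 := hDt1
  have hlt : t₀ < t1 := by
    rcases ht1.eq_or_lt with h | h
    · rw [← h] at hDt1; linarith
    · exact h
  have hbefore : ∀ s ∈ Ico t₀ t1, D s < σ := by
    intro s hs
    by_contra hcon
    push Not at hcon
    have := hmin ⟨⟨hs.1, hs.2.le.trans ht1T⟩, hcon⟩
    linarith [hs.2]
  have hDle : D t1 ≤ σ := by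
    have hcw : ContinuousWithinAt D (Ico t₀ t1) t1 :=
      (hDc t1 hlt.le).mono (fun s hs => hs.1)
    have : (nhdsWithin t1 (Ico t₀ t1)).NeBot := by
      apply mem_closure_iff_nhdsWithin_neBot.1
      rw [closure_Ico hlt.ne]
      exact ⟨hlt.le, le_rfl⟩
    refine le_of_tendsto hcw ?_
    filter_upwards [self_mem_nhdsWithin] with s hs
    exact (hbefore s hs).le
  have hanti : AntitoneOn V (Icc t₀ t1) := by
    apply antitoneOn_of_deriv_nonpos (convex_Icc _ _) (hVc.mono Icc_subset_Ici_self)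
    · intro s hs
      rw [interior_Icc] at hs
      obtain ⟨v, hv, _⟩ := hder s hs.1 ((hbefore s ⟨hs.1.le, hs.2⟩).le.trans hσr)
      exact hv.differentiableAt.differentiableWithinAt
    · intro s hs
      rw [interior_Icc] at hs
      obtain ⟨v, hv, hv2⟩ := hder s hs.1 ((hbefore s ⟨hs.1.le, hs.2⟩).le.trans hσr)
      rw [hv.deriv]
      have := mul_nonneg hc.le (hD0 s)
      linarith
  have e1 := hanti (left_mem_Icc.2 hlt.le) (right_mem_Icc.2 hlt.le) hlt.le
  have e2 := hup t₀ le_rfl (h1.le.trans hσr)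
  have e3 := hlow t1 hlt.le (hDle.trans hσr)
  have e4 := mul_le_mul_of_nonneg_left hDt1 hc0.le
  linarith

lemma lyap_attr {V D g : ℝ → ℝ} {t₀ c c0 K : ℝ} (ht₀ : 0 ≤ t₀) (hc : 0 < c) (hc0 : 0 < c0)
    (hK : 0 < K) (hD0 : ∀ t, 0 ≤ D t)
    (hg1 : ∀ t, 0 ≤ t → 1 ≤ g t) (hgc : ContinuousOn g (Ici 0))
    (hint : Tendsto (fun T => ∫ t in (0:ℝ)..T, 1 / g t) atTop atTop)
    (hlow : ∀ t, t₀ ≤ t → c0 * D t ≤ V t)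
    (hup : ∀ t, t₀ ≤ t → V t ≤ K * (g t * D t))
    (hder : ∀ t, t₀ < t → ∃ v, HasDerivAt V v t ∧ v ≤ - c * D t) :
    Tendsto D atTop (nhds 0) := by
  set h : ℝ → ℝ := fun T => ∫ t in (0:ℝ)..T, 1 / g t with hh
  have hgi : ContinuousOn (fun t => 1 / g t) (Ici 0) :=
    continuousOn_const.div hgc (fun t ht => by have := hg1 t ht; positivity)
  have hhd : ∀ t, 0 < t → HasDerivAt h (1 / g t) t := by
    intro t ht
    apply intervalIntegral.integral_hasDerivAt_right
    · exact (hgi.mono Icc_subset_Ici_self).intervalIntegrable_of_Icc ht.le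
    · exact (hgi.mono Ioi_subset_Ici_self).stronglyMeasurableAtFilter isOpen_Ioi t ht
    · exact hgi.continuousAt (Ici_mem_nhds ht)
  set E : ℝ → ℝ := fun t => V t * rexp (c / K * h t) with hE
  have hEd : ∀ t, t₀ < t → ∃ v, HasDerivAt E v t ∧ v ≤ 0 := by
    intro t ht
    obtain ⟨v, hv, hv2⟩ := hder t ht
    have e1 := ((hhd t (ht₀.trans_lt ht)).const_mul (c / K)).exp
    refine ⟨_, hv.fun_mul e1, ?_⟩
    have hgt : 0 < g t := by linarith [hg1 t (ht₀.trans ht.le)]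
    have e2 : V t * (c / K * (1 / g t)) ≤ c * D t := by
      have := hup t ht.le
      calc V t * (c / K * (1 / g t)) ≤ (K * (g t * D t)) * (c / K * (1 / g t)) := by gcongr
        _ = c * D t := by field_simp
    have e3 : v * rexp (c / K * h t) + V t * (rexp (c / K * h t) * (c / K * (1 / g t)))
        = (v + V t * (c / K * (1 / g t))) * rexp (c / K * h t) := by ring
    rw [e3]
    exact mul_nonpos_of_nonpos_of_nonneg (by linarith) (exp_pos _).le
  have hanti : AntitoneOn E (Ici (t₀ + 1)) := by
    apply antitoneOn_of_deriv_nonpos (convex_Ici _)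
    · intro s hs
      obtain ⟨v, hv, _⟩ := hEd s (by linarith [mem_Ici.1 hs])
      exact hv.continuousAt.continuousWithinAt
    · intro s hs
      rw [interior_Ici] at hs
      obtain ⟨v, hv, _⟩ := hEd s (by linarith [mem_Ioi.1 hs])
      exact hv.differentiableAt.differentiableWithinAt
    · intro s hs
      rw [interior_Ici] at hs
      obtain ⟨v, hv, hv2⟩ := hEd s (by linarith [mem_Ioi.1 hs])
      rw [hv.deriv]
      exact hv2
  have hlim : Tendsto (fun t => E (t₀ + 1) / c0 * rexp (-(c / K * h t))) atTop (nhds 0) := by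
    have e1 : Tendsto (fun t => c / K * h t) atTop atTop :=
      Tendsto.const_mul_atTop (by positivity) hint
    have e2 := (tendsto_exp_neg_atTop_nhds_zero.comp e1).const_mul (E (t₀ + 1) / c0)
    simpa using e2
  refine squeeze_zero' (Eventually.of_forall hD0) ?_ hlim
  filter_upwards [eventually_ge_atTop (t₀ + 1)] with t ht
  have e1 : E t ≤ E (t₀ + 1) := hanti (mem_Ici.2 le_rfl) ht ht
  have e2 := hlow t (by linarith)
  have e3 : V t = E t * rexp (-(c / K * h t)) := by
    rw [hE]; simp only; rw [mul_assoc, ← exp_add]; simp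
  have e4 : c0 * D t ≤ E (t₀ + 1) * rexp (-(c / K * h t)) := by
    rw [e3] at e2
    exact e2.trans (mul_le_mul_of_nonneg_right e1 (exp_pos _).le)
  rw [div_mul_eq_mul_div, le_div_iff₀ hc0]
  linarith

/-! ### Assembly -/

section assembly
variable {ε C F : ℝ → ℝ} {a' t₀ : ℝ}

lemma d_eq_sqrt (S : ClassicalSolution ε C F a' t₀) {t : ℝ} (ht : t₀ ≤ t) :
    S.d t = Real.sqrt (qD S t) := by
  rw [qD_eq S ht]; rfl

lemma qD_nonneg (S : ClassicalSolution ε C F a' t₀) (t : ℝ) : 0 ≤ qD S t := by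
  obtain ⟨hY, hX, hU, hP⟩ := q_nonneg S t
  unfold qD
  positivity

lemma qD_small (S : ClassicalSolution ε C F a' t₀) {t ξ ρ : ℝ} (ht : t₀ ≤ t) (hξ : 0 < ξ)
    (hξρ : 2 * ξ ≤ ρ) (hD : qD S t ≤ ξ ^ 2) : ∀ x ∈ Icc (0:ℝ) π, |S.u x t| < ρ := by
  intro x hx
  obtain ⟨hY, hX, hU, hP⟩ := q_nonneg S t
  have hZ : 0 ≤ ε t ^ 2 * qP S t := by positivity
  have h1 : S.u x t ^ 2 ≤ π * qX S t :=
    aux_sup (S.hux t ht) (aux_slice S.cont_ux ht) (S.bc0 t ht) x hx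
  have h2 : qX S t ≤ ξ ^ 2 := by unfold qD at hD; linarith
  have h3 : S.u x t ^ 2 < ρ ^ 2 := by
    have := pi_lt_four
    have e1 : π * qX S t ≤ π * ξ ^ 2 := mul_le_mul_of_nonneg_left h2 pi_pos.le
    have e2 : π * ξ ^ 2 < 4 * ξ ^ 2 := mul_lt_mul_of_pos_right pi_lt_four (by positivity)
    nlinarith
  exact abs_lt_of_sq_lt_sq h3 (by linarith)

lemma qPhi_le (S : ClassicalSolution ε C F a' t₀) {t K : ℝ} {Ψ : ℝ → ℝ} (ht : t₀ ≤ t)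
    (hΨ : Continuous Ψ)
    (h : ∀ x ∈ Icc (0:ℝ) π, Ψ (S.u x t) ≤ K * S.u x t ^ 2 / 2) :
    qPhi S Ψ t ≤ K / 2 * qU S t := by
  have h1 := aux_slice S.cont_u ht
  have h2 : ContinuousOn (fun x => Ψ (S.u x t)) (Icc 0 π) := hΨ.comp_continuousOn h1
  unfold qPhi qU
  rw [← intervalIntegral.integral_const_mul]
  apply intervalIntegral.integral_mono_on pi_pos.le (aux_ii h2) (aux_ii (by fun_prop))
  intro x hx
  have := h x hx
  linarith

lemma qPhi_ge (S : ClassicalSolution ε C F a' t₀) {t K : ℝ} {Ψ : ℝ → ℝ} (ht : t₀ ≤ t)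
    (hΨ : Continuous Ψ)
    (h : ∀ x ∈ Icc (0:ℝ) π, - Ψ (S.u x t) ≤ K * S.u x t ^ 2 / 2) :
    - qPhi S Ψ t ≤ K / 2 * qU S t := by
  have := qPhi_le S (Ψ := fun z => - Ψ z) ht hΨ.neg h
  unfold qPhi at this ⊢
  rwa [intervalIntegral.integral_neg] at this

lemma qVD_cont (S : ClassicalSolution ε C F a' t₀) {ε' Ψ : ℝ → ℝ} {γ θ : ℝ}
    (hΨ : Continuous Ψ) (h1 : ContinuousOn ε (Ici t₀)) (h2 : ContinuousOn ε' (Ici t₀))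
    (h3 : ContinuousOn C (Ici t₀)) :
    ContinuousOn (qV S ε' Ψ γ θ) (Ici t₀) ∧ ContinuousOn (qD S) (Ici t₀) := by
  obtain ⟨c1, c2, c3, c4, c5, c6, c7⟩ := q_cont S hΨ
  constructor
  · unfold qV
    fun_prop
  · unfold qD
    fun_prop

end assembly

/-- Existence of a lower bound for the derivative near zero. -/
lemma exists_L {F' : ℝ → ℝ} (hF' : Continuous F') (ρ : ℝ) :
    ∃ L, 0 ≤ L ∧ ∀ z, |z| < ρ → - F' z ≤ L := by
  obtain ⟨L, hL⟩ := (isCompact_Icc (a := -ρ) (b := ρ)).exists_bound_of_continuousOn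
    hF'.continuousOn
  refine ⟨max L 0, le_max_right _ _, fun z hz => ?_⟩
  have h1 := hL z ⟨(abs_lt.1 hz).1.le, (abs_lt.1 hz).2.le⟩
  rw [Real.norm_eq_abs] at h1
  exact (neg_le_abs _).trans (h1.trans (le_max_left _ _))

set_option maxHeartbeats 2000000 in
/-- Theorem 3.1 (asymptotic stability): if moreover `∫₀^∞ dt/g(t) = ∞`, where
`g(t) = C(t) - ε'(t)/2 + 1`, then the null solution is asymptotically stable:
it is stable and moreover attractive. -/
theorem null_solution_asymptotically_stable
    (ε ε' ε'' C C' F F' : ℝ → ℝ) (a' A τ k ρ μ Cbar εbar ebar : ℝ)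
    (hεderiv : ∀ t ∈ Ici (0:ℝ), HasDerivWithinAt ε (ε' t) (Ici 0) t)
    (hε'deriv : ∀ t ∈ Ici (0:ℝ), HasDerivWithinAt ε' (ε'' t) (Ici 0) t)
    (hε''cont : ContinuousOn ε'' (Ici 0))
    (hεnonneg : ∀ t ∈ Ici (0:ℝ), 0 ≤ ε t)
    (hCderiv : ∀ t ∈ Ici (0:ℝ), HasDerivWithinAt C (C' t) (Ici 0) t)
    (hC'cont : ContinuousOn C' (Ici 0))
    (hFderiv : ∀ z, HasDerivAt F (F' z) z)
    (hF'cont : Continuous F')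
    (hF0 : F 0 = 0)
    (hCbar : IsGLB (C '' Ioi (0:ℝ)) Cbar) (hCbarpos : 0 < Cbar)
    (hεbar : IsGLB (ε '' Ioi (0:ℝ)) εbar)
    (hebar : IsGLB (ε'' '' Ioi (0:ℝ)) ebar)
    (hA : 0 ≤ A) (hτ : 0 ≤ τ) (hk : 0 ≤ k) (hρ : 0 < ρ) (hμ : 0 < μ)
    (hFk : ∀ z, |z| < ρ → F' z ≤ k)
    (hCk : k ≤ Cbar)
    (hdiss : ∀ t ∈ Ici (0:ℝ), μ * (1 + ε t) ≤ C t - ε' t)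
    (hmuk : 0 < μ + Cbar / 2 - 2 * k)
    (ha' : 0 ≤ a')
    (ha'ε : 0 < a' + εbar / 2)
    (hC' : (∀ t ∈ Ici (0:ℝ), C' t ≤ 0) ∨ Tendsto C' atTop (nhds 0))
    (hg : Tendsto (fun T => ∫ t in (0:ℝ)..T, 1 / (C t - ε' t / 2 + 1)) atTop atTop)
    :
    (∃ ξ, 0 < ξ ∧ ξ ≤ ρ ∧ ∃ κ, 0 ≤ κ ∧
      ∀ σ, 0 < σ → σ ≤ ξ → ∀ t₀, κ ≤ t₀ →
        ∃ δ, 0 < δ ∧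
          ∀ S : ClassicalSolution ε C F a' t₀,
            (∀ x ∈ Icc (0:ℝ) π, ∀ t ∈ Ici t₀, S.aa x t ≤ A * S.d t ^ τ) →
            S.d t₀ < δ → ∀ t, t₀ ≤ t → S.d t < σ) ∧
    (∃ κ, 0 ≤ κ ∧ ∀ t₀, κ ≤ t₀ →
      ∃ δ, 0 < δ ∧
        ∀ S : ClassicalSolution ε C F a' t₀,
          (∀ x ∈ Icc (0:ℝ) π, ∀ t ∈ Ici t₀, S.aa x t ≤ A * S.d t ^ τ) →
          S.d t₀ < δ → Tendsto S.d atTop (nhds 0)) := by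
  have hFc : Continuous F := continuous_iff_continuousAt.2 fun z => (hFderiv z).continuousAt
  obtain ⟨Ψ, hΨ, hΨ0⟩ : ∃ Ψ : ℝ → ℝ, (∀ z, HasDerivAt Ψ (F z) z) ∧ Ψ 0 = 0 :=
    ⟨fun z => ∫ s in (0:ℝ)..z, F s, fun z => hFc.integral_hasStrictDerivAt 0 z |>.hasDerivAt,
      by simp⟩
  have hΨc : Continuous Ψ := continuous_iff_continuousAt.2 fun z => (hΨ z).continuousAt
  obtain ⟨L, hL0, hL⟩ := exists_L hF'cont ρ
  have hFup := aux_F hFderiv hF0 hFk hΨ hΨ0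
  have hFdn := aux_F (G := fun z => - F z) (G' := fun z => - F' z) (Ψ := fun z => - Ψ z)
    (k := L) (ρ := ρ) (fun z => (hFderiv z).neg) (by simp [hF0]) hL (fun z => (hΨ z).neg)
    (by simp [hΨ0])
  have hεc : ContinuousOn ε (Ici 0) := fun t ht => (hεderiv t ht).continuousWithinAt
  have hε'c : ContinuousOn ε' (Ici 0) := fun t ht => (hε'deriv t ht).continuousWithinAt
  have hCc : ContinuousOn C (Ici 0) := fun t ht => (hCderiv t ht).continuousWithinAt
  have hCge' : ∀ t, 0 < t → Cbar ≤ C t := fun t ht => hCbar.1 (mem_image_of_mem _ ht)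
  have hCge : ∀ t, 0 ≤ t → Cbar ≤ C t := by
    intro t ht
    rcases ht.eq_or_lt with h | h
    · subst h
      have hcw : ContinuousWithinAt C (Ioi 0) 0 := (hCc 0 self_mem_Ici).mono Ioi_subset_Ici_self
      refine ge_of_tendsto hcw ?_
      filter_upwards [self_mem_nhdsWithin] with s hs
      exact hCge' s hs
    · exact hCge' t h
  have hεge : ∀ t, 0 < t → εbar ≤ ε t := fun t ht => hεbar.1 (mem_image_of_mem _ ht)
  have hebge : ∀ t, 0 < t → ebar ≤ ε'' t := fun t ht => hebar.1 (mem_image_of_mem _ ht)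
  have hεbar0 : 0 ≤ εbar := by
    apply hεbar.2
    rintro _ ⟨t, ht, rfl⟩
    exact hεnonneg t (Ioi_subset_Ici_self ht)
  obtain ⟨m, hm⟩ : ∃ m, m = μ + Cbar / 2 - 2 * k := ⟨_, rfl⟩
  have hm0 : 0 < m := by rw [hm]; exact hmuk
  obtain ⟨lam, hlam⟩ : ∃ lam, lam = a' + εbar / 2 := ⟨_, rfl⟩
  have hlam0 : 0 < lam := by rw [hlam]; exact ha'ε
  obtain ⟨θ, hθ⟩ : ∃ θ, θ = 2 * a' + 2 * k / μ + (4 / m) * (|ebar| / 2 + 1) := ⟨_, rfl⟩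
  have p1 : 0 ≤ 2 * k / μ := by positivity
  have p2 : 0 ≤ (4 / m) * (|ebar| / 2 + 1) := by positivity
  have hθ0 : 0 ≤ θ := by rw [hθ]; positivity
  have hθ1 : 2 * a' ≤ θ := by rw [hθ]; linarith
  have hθ2 : 2 * k ≤ θ * μ := by
    rw [← div_le_iff₀ hμ, hθ]; linarith
  have hθ3 : |ebar| / 2 + 1 ≤ θ * (m / 4) := by
    have h1 : (4 / m) * (|ebar| / 2 + 1) ≤ θ := by rw [hθ]; linarith
    have h2 := mul_le_mul_of_nonneg_right h1 (by positivity : 0 ≤ m / 4)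
    have h3 : (4 / m) * (|ebar| / 2 + 1) * (m / 4) = |ebar| / 2 + 1 := by field_simp
    linarith
  obtain ⟨Q, hQ⟩ : ∃ Q, Q = A ^ 2 / (4 * (μ / 2)) + θ + θ * (A ^ 2 / (4 * (m / 4))) + 1 :=
    ⟨_, rfl⟩
  have hQ0 : 0 ≤ Q := by rw [hQ]; positivity
  obtain ⟨γ, hγ⟩ : ∃ γ, γ = 2 * (θ ^ 2 / m) + 2 + Q / lam := ⟨_, rfl⟩
  have p3 : 0 ≤ Q / lam := by positivity
  have p4 : 0 ≤ 2 * (θ ^ 2 / m) := by positivity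
  have hγ1 : 2 * (θ ^ 2 / m) + 2 ≤ γ := by rw [hγ]; linarith
  have hγ0 : 0 ≤ γ := by linarith
  have hγ2 : Q ≤ γ * lam := by
    rw [← div_le_iff₀ hlam0, hγ]; linarith
  rw [hQ] at hγ2
  obtain ⟨κ, hκ0, hκ⟩ : ∃ κ, 0 ≤ κ ∧ ∀ t, κ ≤ t → (1 + γ) * C' t ≤ 1 := by
    rcases hC' with h | h
    · refine ⟨0, le_rfl, fun t ht => ?_⟩
      have := mul_nonpos_of_nonneg_of_nonpos (by linarith : 0 ≤ 1 + γ) (h t ht)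
      linarith
    · have hpos : 0 < 1 / (1 + γ) := by positivity
      obtain ⟨κ, hκ⟩ := eventually_atTop.1 (h.eventually_le_const hpos)
      refine ⟨max κ 0, le_max_right _ _, fun t ht => ?_⟩
      have h1 := hκ t ((le_max_left _ _).trans ht)
      rw [le_div_iff₀ (by linarith)] at h1
      linarith
  obtain ⟨K, hK⟩ : ∃ K, K = γ * (3 / 2 + L / 2) + 2 + a' / μ + L / 2
      + θ * (1 + 1 / μ + a' / 2) := ⟨_, rfl⟩
  have hK0 : 0 < K := by rw [hK]; positivity
  obtain ⟨c0, hc0⟩ : ∃ c0, c0 = min (1 / 4) (m / 8) := ⟨_, rfl⟩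
  have hc0p : 0 < c0 := by rw [hc0]; positivity
  obtain ⟨c, hc⟩ : ∃ c, c = min (μ / 2) (1 / 4) := ⟨_, rfl⟩
  have hcp : 0 < c := by rw [hc]; positivity
  obtain ⟨ξ, hξ⟩ : ∃ ξ, ξ = min (ρ / 2) 1 := ⟨_, rfl⟩
  have hξ0 : 0 < ξ := by rw [hξ]; positivity
  have hξρ : 2 * ξ ≤ ρ := by have := min_le_left (ρ / 2) 1; rw [hξ]; linarith
  have hξ1 : ξ ≤ 1 := by rw [hξ]; exact min_le_right _ _
  have hg1 : ∀ t, 0 ≤ t → 1 ≤ C t - ε' t / 2 + 1 := by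
    intro t ht
    have h1 := hdiss t ht
    have h2 := mul_nonneg hμ.le (hεnonneg t ht)
    have h3 := hCge t ht
    linarith
  have hgc : ContinuousOn (fun t => C t - ε' t / 2 + 1) (Ici 0) := by fun_prop
  -- the key estimates
  have core : ∀ t₀, κ ≤ t₀ → ∀ S : ClassicalSolution ε C F a' t₀,
      (∀ x ∈ Icc (0:ℝ) π, ∀ t ∈ Ici t₀, S.aa x t ≤ A * S.d t ^ τ) →
      (∀ t, t₀ ≤ t → qD S t ≤ ξ ^ 2 → c0 * qD S t ≤ qV S ε' Ψ γ θ t) ∧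
      (∀ t, t₀ ≤ t → qD S t ≤ ξ ^ 2 →
        qV S ε' Ψ γ θ t ≤ K * ((C t - ε' t / 2 + 1) * qD S t)) ∧
      (∀ t, t₀ < t → qD S t ≤ ξ ^ 2 →
        ∃ v, HasDerivAt (qV S ε' Ψ γ θ) v t ∧ v ≤ - c * qD S t) := by
    intro t₀ ht₀ S haa
    have ht₀' : 0 ≤ t₀ := hκ0.trans ht₀
    refine ⟨fun t ht hD => ?_, fun t ht hD => ?_, fun t ht hD => ?_⟩
    · have ht0 := ht₀'.trans ht
      have hsm := qD_small S ht hξ0 hξρ hD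
      rw [hc0]
      exact qV_lower S ht hk (hCge t ht0) hCk hμ (hdiss t ht0) (hεnonneg t ht0) ha' hm hm0 hθ0
        hγ1 (qPhi_le S ht hΨc fun x hx => (hFup _ (hsm x hx)).2)
    · have ht0 := ht₀'.trans ht
      have hsm := qD_small S ht hξ0 hξρ hD
      rw [hK]
      exact qV_upper S ht (hCbarpos.le.trans (hCge t ht0)) hμ (hdiss t ht0) (hεnonneg t ht0) ha'
        hθ0 hγ0 hL0 (qPhi_ge S ht hΨc fun x hx => (hFdn _ (hsm x hx)).2)
    · have ht0 : 0 < t := ht₀'.trans_lt ht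
      have hsm := qD_small S ht.le hξ0 hξρ hD
      have hn := Ici_mem_nhds ht0
      have hd1 : S.d t ≤ 1 := by
        rw [d_eq_sqrt S ht.le]
        exact Real.sqrt_le_one.2 (hD.trans (pow_le_one₀ hξ0.le hξ1))
      have hd0 : 0 ≤ S.d t := Real.sqrt_nonneg _
      have haA : ∀ x ∈ Icc (0:ℝ) π, S.aa x t ≤ A := by
        intro x hx
        refine (haa x hx t ht.le).trans ?_
        exact mul_le_of_le_one_right hA (Real.rpow_le_one hd0 hd1 hτ)
      obtain ⟨N, R1, R2, R3, T, H, hN, hR1, hR2, hR3, hT, hH, hV⟩ :=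
        qV_deriv S (γ := γ) (θ := θ) (A := A) (k := k) (ε' := ε') (ε'' := ε'') (C' := C')
          hFderiv hF'cont hF0 hΨ ht
          ((hεderiv t ht0.le).hasDerivAt hn) ((hε'deriv t ht0.le).hasDerivAt hn)
          ((hCderiv t ht0.le).hasDerivAt hn) haA (fun x hx => hFk _ (hsm x hx))
          (fun x hx => (hFup _ (hsm x hx)).1)
      refine ⟨_, hV, ?_⟩
      obtain ⟨hY, hX, hU, hP⟩ := q_nonneg S t
      rw [hc]
      exact deriv_bound hk (hCge t ht0.le) hCbarpos hμ hm0 hm ha' (hεnonneg t ht0.le)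
        (hdiss t ht0.le) (lam := lam) (by rw [hlam]; linarith [hεge t ht0]) (hebge t ht0) hθ0 hγ0
        (hκ t (ht₀.trans ht.le)) hθ1 hθ2 hθ3 hγ2 hX hY hP (qU_le S ht.le) hN hR1
        (hR2 _ (by positivity)) (hR3 _ (by positivity)) hT hH
  -- stability
  have stab : ∀ σ, 0 < σ → σ ≤ ξ → ∀ t₀, κ ≤ t₀ → ∃ δ, 0 < δ ∧
      ∀ S : ClassicalSolution ε C F a' t₀,
        (∀ x ∈ Icc (0:ℝ) π, ∀ t ∈ Ici t₀, S.aa x t ≤ A * S.d t ^ τ) →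
        S.d t₀ < δ → ∀ t, t₀ ≤ t → qD S t < σ ^ 2 := by
    intro σ hσ hσξ t₀ ht₀
    have ht₀' : 0 ≤ t₀ := hκ0.trans ht₀
    have hgt := hg1 t₀ ht₀'
    have hgp : 0 < C t₀ - ε' t₀ / 2 + 1 := by linarith
    have hq : 0 < c0 / (K * (C t₀ - ε' t₀ / 2 + 1)) := by positivity
    refine ⟨min σ (σ * Real.sqrt (c0 / (K * (C t₀ - ε' t₀ / 2 + 1)))),
      lt_min hσ (mul_pos hσ (Real.sqrt_pos.2 hq)), fun S haa hd => ?_⟩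
    obtain ⟨hlow, hup, hder⟩ := core t₀ ht₀ S haa
    have hsub : Ici t₀ ⊆ Ici 0 := Ici_subset_Ici.2 ht₀'
    obtain ⟨hVc, hDc⟩ := qVD_cont S (ε' := ε') (γ := γ) (θ := θ) hΨc (hεc.mono hsub)
      (hε'c.mono hsub) (hCc.mono hsub)
    have hd0 : 0 ≤ S.d t₀ := Real.sqrt_nonneg _
    have hdsq : S.d t₀ ^ 2 = qD S t₀ := by
      rw [d_eq_sqrt S le_rfl, Real.sq_sqrt (qD_nonneg S t₀)]
    have e1 : S.d t₀ ^ 2 < σ ^ 2 :=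
      pow_lt_pow_left₀ (hd.trans_le (min_le_left _ _)) hd0 two_ne_zero
    have e2 := pow_lt_pow_left₀ (hd.trans_le (min_le_right _ _)) hd0 two_ne_zero
    rw [hdsq] at e1 e2
    rw [mul_pow, Real.sq_sqrt hq.le, ← mul_div_assoc, lt_div_iff₀ (by positivity)] at e2
    refine lyap_stable (g := fun t => C t - ε' t / 2 + 1) hcp hc0p hVc hDc (qD_nonneg S)
      hlow hup hder (pow_le_pow_left₀ hσ.le hσξ 2) e1 ?_
    linarith
  refine ⟨⟨ξ, hξ0, by linarith, κ, hκ0, fun σ hσ hσξ t₀ ht₀ => ?_⟩, κ, hκ0, fun t₀ ht₀ => ?_⟩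
  · obtain ⟨δ, hδ, h⟩ := stab σ hσ hσξ t₀ ht₀
    refine ⟨δ, hδ, fun S haa hd t ht => ?_⟩
    rw [d_eq_sqrt S ht, Real.sqrt_lt' hσ]
    exact h S haa hd t ht
  · obtain ⟨δ, hδ, h⟩ := stab ξ hξ0 le_rfl t₀ ht₀
    refine ⟨δ, hδ, fun S haa hd => ?_⟩
    have hle := fun t ht => (h S haa hd t ht).le
    obtain ⟨hlow, hup, hder⟩ := core t₀ ht₀ S haa
    have hlim := lyap_attr (V := qV S ε' Ψ γ θ) (g := fun t => C t - ε' t / 2 + 1)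
      (hκ0.trans ht₀) hcp hc0p hK0 (qD_nonneg S) hg1 hgc hg
      (fun t ht => hlow t ht (hle t ht)) (fun t ht => hup t ht (hle t ht))
      (fun t ht => hder t ht (hle t ht.le))
    have h2 := (Real.continuous_sqrt.tendsto 0).comp hlim
    rw [Real.sqrt_zero] at h2
    refine h2.congr' ?_
    filter_upwards [eventually_ge_atTop t₀] with t ht
    exact (d_eq_sqrt S ht).symm
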